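/- Fix θ = (σ,δ,α) with σ > 0, δ > 0, α ∈ (0,2). There exist C > 0 and N ∈ ℕ such that for all n ≥ N: | ∫_ℝ (h_α(y, w_n(θ)) l_α(y, w_n(θ)) / f_α(y, w_n(θ))) dy + α κ₀(θ) κ₁(θ) / (n^{1−α/2} (ln n)^{α/2}) | ≤ C (1/(n^{1−α/2} (ln n)^{α/2})) · (ln(ln n))²/(ln n)^{min(1/4, α)}. -/

import Mathlib

open MeasureTheory Filter Set Topology Matrix

noncomputable section

namespace LevyLAN

/-- Standard Gaussian density `φ`. -/
def gauss (y : ℝ) : ℝ := (Real.sqrt (2 * Real.pi))⁻¹ * Real.exp (-(y ^ 2) / 2)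

/-- Symmetric `α`-stable density `φ_α`, defined by Fourier inversion. -/
def stableDensity (α z : ℝ) : ℝ :=
  (2 * Real.pi)⁻¹ * ∫ u : ℝ, Real.cos (z * u) * Real.exp (-(|u| ^ α))

/-- `∂_α φ_α`. -/
def stableDensityDalpha (α z : ℝ) : ℝ :=
  -(2 * Real.pi)⁻¹ * ∫ u : ℝ, Real.cos (z * u) * |u| ^ α * Real.log |u| * Real.exp (-(|u| ^ α))

/-- The operator `(D f) y = (y * f y)' = f y + y * f' y`. -/
def Dop (f : ℝ → ℝ) (y : ℝ) : ℝ := f y + y * deriv f y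

/-- `f_α(y, w)`. -/
def fFun (α y w : ℝ) : ℝ := ∫ z : ℝ, gauss (y - w * z) * stableDensity α z

/-- `g_α(y, w)`. -/
def gFun (α y w : ℝ) : ℝ := ∫ z : ℝ, Dop gauss (y - w * z) * stableDensity α z

/-- `h_α(y, w)`. -/
def hFun (α y w : ℝ) : ℝ := ∫ z : ℝ, gauss (y - w * z) * Dop (stableDensity α) z

/-- `k_α(y, w)`. -/
def kFun (α y w : ℝ) : ℝ := ∫ z : ℝ, gauss (y - w * z) * stableDensityDalpha α z

/-- `c_α`. -/
def cAlpha (α : ℝ) : ℝ :=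
  if α = 1 then 1 / Real.pi
  else -(α * (α - 1)) / (2 * Real.Gamma (2 - α) * Real.cos (Real.pi * α / 2))

/-- `w_n(θ) = n^{1/2 - 1/α} δ / σ`. -/
def wn (n : ℕ) (σ δ α : ℝ) : ℝ := (n : ℝ) ^ ((1 : ℝ) / 2 - 1 / α) * δ / σ

/-- `l_α(y, w)` (it depends on `n`). -/
def lFun (n : ℕ) (α y w : ℝ) : ℝ :=
  ((Real.log n - Real.log (Real.log n)) / (2 * α) - Real.log n / α ^ 2) * hFun α y w
    + kFun α y w

def kappa0 (σ δ α : ℝ) : ℝ := 2 * cAlpha α / (α * (2 - α) ^ (α / 2)) * (δ / σ) ^ α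

def kappa1 (σ δ α : ℝ) : ℝ :=
  Real.log (δ / σ) + deriv cAlpha α / cAlpha α - Real.log (2 - α) / 2 - 1 / α

/-- The density `p_{1/n}(y, θ)`, with parameter `θ = (σ, δ, α) : Fin 3 → ℝ`. -/
def pdens (n : ℕ) (θ : Fin 3 → ℝ) (y : ℝ) : ℝ :=
  Real.sqrt n / θ 0 * fFun (θ 2) (Real.sqrt n * y / θ 0) (wn n (θ 0) (θ 1) (θ 2))

/-- The log-likelihood `ln L_n(θ)`. -/
def logLik (n : ℕ) (θ : Fin 3 → ℝ) (x : Fin n → ℝ) : ℝ :=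
  ∑ i, Real.log (pdens n θ (x i))

/-- Partial derivative in the `j`-th parameter coordinate. -/
def pderiv (j : Fin 3) (F : (Fin 3 → ℝ) → ℝ) (θ : Fin 3 → ℝ) : ℝ :=
  deriv (fun t => F (Function.update θ j t)) (θ j)

/-- The score `G_n(θ) = ∇_θ ln L_n(θ)`. -/
def scoreVec (n : ℕ) (θ : Fin 3 → ℝ) (x : Fin n → ℝ) : Fin 3 → ℝ :=
  fun j => pderiv j (fun θ' => logLik n θ' x) θ

/-- The Hessian matrix `J_n(θ)` of the log-likelihood. -/
def hessMat (n : ℕ) (θ : Fin 3 → ℝ) (x : Fin n → ℝ) : Matrix (Fin 3) (Fin 3) ℝ :=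
  Matrix.of fun i j => pderiv i (fun θ' => pderiv j (fun θ'' => logLik n θ'' x) θ') θ

def rate (n : ℕ) (α : ℝ) : ℝ := Real.log n ^ (α / 4) / (n : ℝ) ^ (α / 4)

/-- The rate matrix `u_n(θ)`. -/
def un (n : ℕ) (θ : Fin 3 → ℝ) : Matrix (Fin 3) (Fin 3) ℝ :=
  !![1 / Real.sqrt n, 0, 0;
     0, rate n (θ 2), -(rate n (θ 2) * (θ 1 / (2 * θ 2)) * (Real.log n - Real.log (Real.log n)));
     0, 0, rate n (θ 2)]

/-- The information matrix `I(θ)`. -/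
def Imat (θ : Fin 3 → ℝ) : Matrix (Fin 3) (Fin 3) ℝ :=
  !![2 / θ 0 ^ 2, 0, 0;
     0, θ 2 ^ 2 / θ 1 ^ 2 * kappa0 (θ 0) (θ 1) (θ 2),
        θ 2 / θ 1 * kappa0 (θ 0) (θ 1) (θ 2) * kappa1 (θ 0) (θ 1) (θ 2);
     0, θ 2 / θ 1 * kappa0 (θ 0) (θ 1) (θ 2) * kappa1 (θ 0) (θ 1) (θ 2),
        kappa0 (θ 0) (θ 1) (θ 2) * (kappa1 (θ 0) (θ 1) (θ 2) ^ 2 + 1 / θ 2 ^ 2)]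

/-- `ℙ_n`, the `n`-fold product of the law with Lebesgue density `p_{1/n}(·, θ)`. -/
def Pn (n : ℕ) (θ : Fin 3 → ℝ) : Measure (Fin n → ℝ) :=
  Measure.pi fun _ => MeasureTheory.volume.withDensity fun y => ENNReal.ofReal (pdens n θ y)

/-- The standard Gaussian measure on `ℝ³`. -/
def stdGauss3 : Measure (Fin 3 → ℝ) :=
  Measure.pi fun _ => ProbabilityTheory.gaussianReal 0 1

/-- Euclidean (Frobenius) norm of a real 3×3 matrix. -/
def frobNorm (M : Matrix (Fin 3) (Fin 3) ℝ) : ℝ := Real.sqrt (∑ i, ∑ j, M i j ^ 2)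

/-- Euclidean norm of a vector of `ℝ³`. -/
def vecNorm (v : Fin 3 → ℝ) : ℝ := Real.sqrt (∑ j, v j ^ 2)

/-- The admissible families of functions `ψ_α^{(p)}`. -/
structure IsPsiFamily (ψ : ℝ → ℕ → ℝ → ℝ) : Prop where
  contDiff : ∀ α ∈ Set.Ioo (0 : ℝ) 2, ∀ p : ℕ, ContDiff ℝ 2 (ψ α p)
  pos : ∀ α ∈ Set.Ioo (0 : ℝ) 2, ∀ p : ℕ, ∀ y : ℝ, 0 < ψ α p y
  even : ∀ α ∈ Set.Ioo (0 : ℝ) 2, ∀ p : ℕ, ∀ y : ℝ, ψ α p (-y) = ψ α p y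
  eq_one : ∀ α ∈ Set.Ioo (0 : ℝ) 2, ∀ p : ℕ, ∀ y : ℝ, |y| ≤ 1 → ψ α p y = 1
  eq_tail : ∀ α ∈ Set.Ioo (0 : ℝ) 2, ∀ p : ℕ, ∀ y : ℝ, 3 ≤ |y| →
    ψ α p y = Real.log |y| ^ p / |y| ^ (α + 1)
  unifBound : ∀ K : Set ℝ, K ⊆ Set.Ioo (0 : ℝ) 2 → IsCompact K → ∀ p : ℕ,
    ∃ c > (0 : ℝ), ∃ C : ℝ, ∀ α ∈ K, ∀ y : ℝ, 1 ≤ |y| → |y| ≤ 3 →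
      c ≤ ψ α p y ∧ ψ α p y ≤ C

/-- `𝓘_α^{(k,l)}`. -/
def Ical (ψ : ℝ → ℕ → ℝ → ℝ) (α : ℝ) (k l : ℕ) (y : ℝ) : ℝ :=
  ∫ z in {z : ℝ | 1 < |z|}, Dop^[k] gauss (y - z) * ψ α l z

/-- `f_α^{(k,l,m)}`. -/
def fklm (α : ℝ) (k l m : ℕ) (y w : ℝ) : ℝ :=
  ∫ z : ℝ, Dop^[k] gauss (y - w * z)
    * Dop^[l] (fun z' => iteratedDeriv m (fun a => stableDensity a z') α) z

def Gamman (n : ℕ) (α : ℝ) : ℝ := Real.sqrt ((1 - α / 2) * Real.log n)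

def Mn (n : ℕ) (α : ℝ) : ℝ := Real.sqrt ((2 - α) * Real.log n)

def Kconst (σ δ α : ℝ) : ℝ := deriv cAlpha α + cAlpha α * Real.log (δ / σ)


/-- Change of variables `t = e^s`. -/
lemma integral_exp_subst (g : ℝ → ℂ) :
    ∫ t in Ioi (0:ℝ), g t = ∫ s : ℝ, (Real.exp s : ℂ) * g (Real.exp s) := by
  have h := integral_image_eq_integral_abs_deriv_smul (s := univ) (f := Real.exp) (f' := Real.exp)
    MeasurableSet.univ (fun x _ => (Real.hasDerivAt_exp x).hasDerivWithinAt)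
    Real.exp_injective.injOn g
  rw [image_univ, Real.range_exp] at h
  rw [h, setIntegral_univ]
  congr 1; ext s
  simp [abs_of_pos (Real.exp_pos s)]

lemma integrable_exp_subst (g : ℝ → ℝ) :
    IntegrableOn g (Ioi (0:ℝ)) ↔ Integrable (fun s : ℝ => Real.exp s * g (Real.exp s)) := by
  have h := integrableOn_image_iff_integrableOn_abs_deriv_smul (s := univ) (f := Real.exp)
    (f' := Real.exp)
    MeasurableSet.univ (fun x _ => (Real.hasDerivAt_exp x).hasDerivWithinAt)
    Real.exp_injective.injOn g
  rw [image_univ, Real.range_exp, integrableOn_univ] at h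
  rw [h]
  simp [abs_of_pos (Real.exp_pos _)]

lemma one_add_abs_le {a : ℝ} (ha : 0 < a) (s : ℝ) :
    1 + |s| ≤ (1 + 2 / a) * (Real.exp (a / 2 * s) + Real.exp (-(a / 2) * s)) := by
  have h1 : 1 ≤ Real.exp (a / 2 * s) + Real.exp (-(a / 2) * s) := by
    rcases le_total 0 s with h | h
    · have := Real.one_le_exp (x := a / 2 * s) (by positivity)
      have := Real.exp_pos (-(a / 2) * s); linarith
    · have := Real.one_le_exp (x := -(a / 2) * s) (by nlinarith)
      have := Real.exp_pos ((a / 2) * s); linarith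
  have h2 : (a / 2) * |s| ≤ Real.exp (a / 2 * s) + Real.exp (-(a / 2) * s) := by
    have p1 := Real.add_one_le_exp (a / 2 * s)
    have p2 := Real.add_one_le_exp (-(a / 2) * s)
    have p3 := Real.exp_pos (a / 2 * s)
    have p4 := Real.exp_pos (-(a / 2) * s)
    rcases abs_cases s with ⟨h, _⟩ | ⟨h, _⟩ <;> rw [h] <;> nlinarith
  have h3 : |s| ≤ 2 / a * (Real.exp (a / 2 * s) + Real.exp (-(a / 2) * s)) := by
    rw [div_mul_eq_mul_div, le_div_iff₀ ha]; linarith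
  linarith

lemma integrable_gam {a : ℝ} (ha : 0 < a) :
    Integrable (fun s : ℝ => Real.exp (a * s - Real.exp s / 2)) := by
  have h : IntegrableOn (fun t : ℝ => t ^ (a - 1) * Real.exp (-(1/2) * t)) (Ioi 0) := by
    have := integrableOn_rpow_mul_exp_neg_mul_rpow (s := a - 1) (p := 1) (b := 1/2) (by linarith) one_pos (by norm_num)
    simpa using this
  rw [integrable_exp_subst] at h
  refine h.congr (Eventually.of_forall fun s => ?_)
  simp only
  rw [← Real.exp_mul, ← mul_assoc, ← Real.exp_add, ← Real.exp_add]
  congr 1; ring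

/-- The envelope. -/
def envl (a s : ℝ) : ℝ := (1 + |s|) * Real.exp (a * s - Real.exp s / 2)

lemma envl_nonneg (a s : ℝ) : 0 ≤ envl a s := by unfold envl; positivity

lemma envl_cont (a : ℝ) : Continuous (envl a) := by unfold envl; fun_prop

lemma envl_le {a : ℝ} (ha : 0 < a) (s : ℝ) : envl a s ≤ (1 + 2 / a) *
    (Real.exp ((3 * a / 2) * s - Real.exp s / 2) + Real.exp ((a / 2) * s - Real.exp s / 2)) := by
  unfold envl
  calc _ ≤ ((1 + 2 / a) * (Real.exp (a / 2 * s) + Real.exp (-(a / 2) * s))) *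
        Real.exp (a * s - Real.exp s / 2) := by gcongr; exact one_add_abs_le ha s
    _ = _ := by
      rw [mul_assoc, add_mul (Real.exp _), ← Real.exp_add, ← Real.exp_add]; ring_nf

lemma integrable_envl {a : ℝ} (ha : 0 < a) : Integrable (envl a) := by
  refine Integrable.mono' (((integrable_gam (a := 3 * a / 2) (by positivity)).add
    (integrable_gam (a := a / 2) (by positivity))).const_mul (1 + 2 / a))
    (envl_cont a).aestronglyMeasurable (Eventually.of_forall fun s => ?_)
  rw [Real.norm_of_nonneg (envl_nonneg a s)]
  exact envl_le ha s

lemma tendsto_gam_top (a : ℝ) :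
    Tendsto (fun s : ℝ => Real.exp (a * s - Real.exp s / 2)) atTop (𝓝 0) := by
  have h := (tendsto_rpow_mul_exp_neg_mul_atTop_nhds_zero a (1/2) (by norm_num)).comp
    Real.tendsto_exp_atTop
  refine h.congr fun s => ?_
  simp only [Function.comp]
  rw [← Real.exp_mul, ← Real.exp_add]; congr 1; ring

lemma tendsto_gam_bot {a : ℝ} (ha : 0 < a) :
    Tendsto (fun s : ℝ => Real.exp (a * s - Real.exp s / 2)) atBot (𝓝 0) := by
  have h : Tendsto (fun s : ℝ => Real.exp (a * s)) atBot (𝓝 0) :=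
    Real.tendsto_exp_atBot.comp (tendsto_id.const_mul_atBot ha)
  refine squeeze_zero (fun s => (Real.exp_pos _).le) (fun s => ?_) h
  apply Real.exp_le_exp.2
  have := Real.exp_pos s; linarith

lemma tendsto_envl_top {a : ℝ} (ha : 0 < a) : Tendsto (envl a) atTop (𝓝 0) := by
  refine squeeze_zero (envl_nonneg a) (envl_le ha) ?_
  simpa using ((tendsto_gam_top (3 * a / 2)).add (tendsto_gam_top (a / 2))).const_mul (1 + 2 / a)

lemma tendsto_envl_bot {a : ℝ} (ha : 0 < a) : Tendsto (envl a) atBot (𝓝 0) := by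
  refine squeeze_zero (envl_nonneg a) (envl_le ha) ?_
  simpa using ((tendsto_gam_bot (a := 3 * a / 2) (by positivity)).add
    (tendsto_gam_bot (a := a / 2) (by positivity))).const_mul (1 + 2 / a)

/-- Shift of a horizontal line of integration. -/
lemma shift_line (G : ℂ → ℂ) (hG : Differentiable ℂ G) (a A : ℝ) (ha : 0 < a)
    (p r : ℝ) (hpr : p ≤ r)
    (hb : ∀ s θ : ℝ, p ≤ θ → θ ≤ r → ‖G (s + θ * Complex.I)‖ ≤ A * envl a s) :
    ∫ s : ℝ, G (s + p * Complex.I) = ∫ s : ℝ, G (s + r * Complex.I) := by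
  have hGc := hG.continuous
  have hInt0 : ∀ θ : ℝ, p ≤ θ → θ ≤ r → Integrable (fun s : ℝ => G (s + θ * Complex.I)) := by
    intro θ h1 h2
    refine Integrable.mono' ((integrable_envl ha).const_mul A) ?_
      (Eventually.of_forall fun s => hb s θ h1 h2)
    exact (by fun_prop : Continuous fun s : ℝ => G (s + θ * Complex.I)).aestronglyMeasurable
  have hrect : ∀ T : ℝ, (∫ x in (-T)..T, G (x + p * Complex.I)) - (∫ x in (-T)..T, G (x + r * Complex.I))
      = -(Complex.I * ∫ θ in p..r, G (T + θ * Complex.I)) +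
        Complex.I * ∫ θ in p..r, G ((-T : ℝ) + θ * Complex.I) := by
    intro T
    have h := Complex.integral_boundary_rect_eq_zero_of_differentiableOn G
      ((-T : ℝ) + p * Complex.I) (T + r * Complex.I) hG.differentiableOn
    simp only [Complex.add_re, Complex.ofReal_re, Complex.mul_re, Complex.I_re, mul_zero,
      Complex.ofReal_im, Complex.I_im, mul_one, sub_self, add_zero, Complex.add_im, Complex.mul_im,
      zero_add, smul_eq_mul] at h
    linear_combination h
  have hvert : ∀ l : Filter ℝ, Tendsto (envl a) l (𝓝 0) →
      Tendsto (fun T : ℝ => ∫ θ in p..r, G (T + θ * Complex.I)) l (𝓝 0) := by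
    intro l hl
    have : Tendsto (fun T => A * envl a T * |r - p|) l (𝓝 0) := by
      simpa using (hl.const_mul A).mul_const |r - p|
    refine squeeze_zero_norm (fun T => ?_) this
    refine intervalIntegral.norm_integral_le_of_norm_le_const fun θ hθ => ?_
    rw [uIoc_of_le hpr] at hθ
    exact hb T θ hθ.1.le hθ.2
  have hlim1 := ((intervalIntegral_tendsto_integral (hInt0 p le_rfl hpr) tendsto_neg_atTop_atBot
    tendsto_id).sub (intervalIntegral_tendsto_integral (hInt0 r hpr le_rfl) tendsto_neg_atTop_atBot
    tendsto_id))
  have hlim2 : Tendsto (fun T : ℝ => -(Complex.I * ∫ θ in p..r, G (T + θ * Complex.I)) +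
        Complex.I * ∫ θ in p..r, G ((-T : ℝ) + θ * Complex.I)) atTop (𝓝 0) := by
    have v1 := hvert atTop (tendsto_envl_top ha)
    have v2 := (hvert atBot (tendsto_envl_bot ha)).comp tendsto_neg_atTop_atBot
    simpa [Function.comp_def] using ((v1.const_mul Complex.I).neg).add (v2.const_mul Complex.I)
  have := tendsto_nhds_unique (hlim1.congr fun T => by simpa using hrect T) (by simpa using hlim2)
  exact sub_eq_zero.1 this



/-- kernel in the logarithmic plane -/
def ker (y : ℝ) (ζ : ℂ) : ℂ := Complex.exp (Complex.I * y * Complex.exp ζ + ζ)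

lemma ker_diff (y : ℝ) : Differentiable ℂ (ker y) := by unfold ker; fun_prop

lemma cexp_re (s θ : ℝ) : (Complex.exp (s + θ * Complex.I)).re = Real.exp s * Real.cos θ := by
  rw [Complex.exp_re]; simp

lemma cexp_im (s θ : ℝ) : (Complex.exp (s + θ * Complex.I)).im = Real.exp s * Real.sin θ := by
  rw [Complex.exp_im]; simp

lemma norm_ker (y s θ : ℝ) :
    ‖ker y (s + θ * Complex.I)‖ = Real.exp (s - y * (Real.exp s * Real.sin θ)) := by
  unfold ker
  rw [Complex.norm_exp]
  congr 1
  rw [Complex.add_re, Complex.mul_re, cexp_re, cexp_im]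
  simp
  ring

lemma gfac_re (s θ : ℝ) : (-Complex.exp (2 * (s + θ * Complex.I)) / 2).re
    = -(Real.exp (2 * s) * Real.cos (2 * θ)) / 2 := by
  have : (2 * (s + θ * Complex.I) : ℂ) = ((2 * s : ℝ) : ℂ) + ((2 * θ : ℝ) : ℂ) * Complex.I := by
    push_cast; ring
  rw [this]
  have h := cexp_re (2 * s) (2 * θ)
  have : ∀ z : ℂ, (-z / 2).re = -z.re / 2 := by
    intro z
    have : (-z / 2 : ℂ) = (-z) / ((2:ℝ):ℂ) := by norm_num
    rw [this, Complex.div_ofReal_re]; simp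
  rw [this, h]

lemma norm_exp_sub_one_le' {x : ℂ} (hx : x.re ≤ 0) : ‖Complex.exp x - 1‖ ≤ 2 * ‖x‖ := by
  rcases le_total ‖x‖ 1 with h | h
  · exact Complex.norm_exp_sub_one_le h
  · have h1 : ‖Complex.exp x‖ ≤ 1 := by rw [Complex.norm_exp]; exact Real.exp_le_one_iff.2 hx
    have := norm_sub_le (Complex.exp x) 1
    simp at this
    linarith

lemma norm_exp_sub_one_sub_le' {x : ℂ} (hx : x.re ≤ 0) :
    ‖Complex.exp x - 1 - x‖ ≤ 3 * ‖x‖ ^ 2 := by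
  rcases le_total ‖x‖ 1 with h | h
  · have := Complex.norm_exp_sub_one_sub_id_le h
    have := sq_nonneg ‖x‖
    linarith
  · have h1 : ‖Complex.exp x‖ ≤ 1 := by rw [Complex.norm_exp]; exact Real.exp_le_one_iff.2 hx
    have := norm_sub_le (Complex.exp x) 1
    have h2 := norm_sub_le (Complex.exp x - 1) x
    simp at this
    nlinarith

lemma integral_scaled_le {β : ℝ} (hβ : 0 < β) {y q : ℝ} (hy : 1 ≤ y) (hq : 0 ≤ q) (hq1 : q ≤ 1) :
    Integrable (fun s : ℝ => (1 + q * |s|) * Real.exp (β * s - y * Real.exp s / 2)) ∧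
    ∫ s : ℝ, (1 + q * |s|) * Real.exp (β * s - y * Real.exp s / 2) ≤
      (∫ s : ℝ, envl β s) * ((1 + q * Real.log y) * y ^ (-β)) := by
  have hy0 : 0 < y := by linarith
  have hl : 0 ≤ Real.log y := Real.log_nonneg hy
  set F : ℝ → ℝ := fun s => (1 + q * |s|) * Real.exp (β * s - y * Real.exp s / 2) with hF
  have hb : ∀ s, F (s - Real.log y) ≤ ((1 + q * Real.log y) * y ^ (-β)) * envl β s := by
    intro s
    have h1 : Real.exp (β * (s - Real.log y) - y * Real.exp (s - Real.log y) / 2)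
        = y ^ (-β) * Real.exp (β * s - Real.exp s / 2) := by
      rw [Real.exp_sub s, Real.exp_log hy0, Real.rpow_def_of_pos hy0, ← Real.exp_add]
      congr 1; field_simp; ring
    have h2 : 1 + q * |s - Real.log y| ≤ (1 + q * Real.log y) * (1 + |s|) := by
      have : |s - Real.log y| ≤ |s| + Real.log y := by
        have := abs_sub s (Real.log y); rwa [abs_of_nonneg hl] at this
      have h3 := mul_le_mul_of_nonneg_left this hq
      have h4 : q * |s| ≤ |s| := mul_le_of_le_one_left (abs_nonneg _) hq1
      have h5 : 0 ≤ q * Real.log y * |s| := by positivity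
      nlinarith
    simp only [hF]
    rw [h1]; unfold envl
    have : 0 ≤ y ^ (-β) * Real.exp (β * s - Real.exp s / 2) := by positivity
    calc _ ≤ ((1 + q * Real.log y) * (1 + |s|)) * (y ^ (-β) * Real.exp (β * s - Real.exp s / 2)) := by
          gcongr
      _ = _ := by ring
  have hFc : Continuous F := by simp only [hF]; fun_prop
  have hFn : ∀ s, 0 ≤ F s := fun s => by simp only [hF]; positivity
  have hInt0 : Integrable (fun s => F (s - Real.log y)) := by
    refine Integrable.mono' ((integrable_envl hβ).const_mul ((1 + q * Real.log y) * y ^ (-β)))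
      (by fun_prop : Continuous fun s => F (s - Real.log y)).aestronglyMeasurable
      (Eventually.of_forall fun s => ?_)
    · rw [Real.norm_of_nonneg (hFn _)]; exact hb s
  constructor
  · have := hInt0.comp_add_right (Real.log y)
    simpa using this
  · rw [← integral_sub_right_eq_self F (Real.log y), mul_comm, ← integral_const_mul]
    exact integral_mono hInt0 ((integrable_envl hβ).const_mul _) hb

def Gfun (y : ℝ) (Q : ℂ → ℂ) (ζ : ℂ) : ℂ := ker y ζ * Complex.exp (-Complex.exp (2 * ζ) / 2) * Q ζ

lemma sin_nonneg' {θ : ℝ} (h0 : 0 ≤ θ) (h1 : θ ≤ Real.pi / 6) : 0 ≤ Real.sin θ :=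
  Real.sin_nonneg_of_nonneg_of_le_pi h0 (by linarith [Real.pi_pos])

lemma cos2_ge {θ : ℝ} (h0 : 0 ≤ θ) (h1 : θ ≤ Real.pi / 6) : 1 / 2 ≤ Real.cos (2 * θ) := by
  rw [← Real.cos_pi_div_three]
  exact Real.cos_le_cos_of_nonneg_of_le_pi (by linarith) (by linarith [Real.pi_pos]) (by linarith)

lemma norm_Gfun_le {α y q A : ℝ} (hy : 0 ≤ y) (hq1 : q ≤ 1) (hA : 0 ≤ A)
    {Q : ℂ → ℂ} {s θ : ℝ} (h0 : 0 ≤ θ) (h1 : θ ≤ Real.pi / 6)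
    (hQ : ‖Q (s + θ * Complex.I)‖ ≤ A * (1 + q * |s|) * Real.exp (α * s)) :
    ‖Gfun y Q (s + θ * Complex.I)‖ ≤ (A * Real.exp 1) * envl (1 + α) s := by
  unfold Gfun
  rw [norm_mul, norm_mul, norm_ker, Complex.norm_exp, gfac_re]
  have e1 : Real.exp (s - y * (Real.exp s * Real.sin θ)) ≤ Real.exp s := by
    apply Real.exp_le_exp.2
    have := mul_nonneg hy (mul_nonneg (Real.exp_pos s).le (sin_nonneg' h0 h1))
    linarith
  have e2 : Real.exp (-(Real.exp (2 * s) * Real.cos (2 * θ)) / 2) ≤ Real.exp (1 - Real.exp s / 2) := by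
    apply Real.exp_le_exp.2
    have h2 := mul_le_mul_of_nonneg_left (cos2_ge h0 h1) (Real.exp_pos (2 * s)).le
    have h3 : Real.exp (2 * s) = Real.exp s ^ 2 := by rw [← Real.exp_nat_mul]; norm_num
    rw [h3] at h2 ⊢
    nlinarith [sq_nonneg (Real.exp s - 1), Real.exp_pos s]
  have e3 : ‖Q (s + θ * Complex.I)‖ ≤ A * (1 + |s|) * Real.exp (α * s) := by
    refine hQ.trans ?_
    have : q * |s| ≤ |s| := mul_le_of_le_one_left (abs_nonneg _) hq1
    gcongr
  calc _ ≤ Real.exp s * Real.exp (1 - Real.exp s / 2) * (A * (1 + |s|) * Real.exp (α * s)) := by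
        gcongr
    _ = A * (1 + |s|) * (Real.exp s * Real.exp (1 - Real.exp s / 2) * Real.exp (α * s)) := by ring
    _ = A * (1 + |s|) * (Real.exp 1 * Real.exp ((1 + α) * s - Real.exp s / 2)) := by
        congr 1; rw [← Real.exp_add, ← Real.exp_add, ← Real.exp_add]; congr 1; ring
    _ = _ := by unfold envl; ring

lemma Gfun_diff (y : ℝ) {Q : ℂ → ℂ} (hQd : Differentiable ℂ Q) : Differentiable ℂ (Gfun y Q) := by
  have := ker_diff y
  unfold Gfun; fun_prop

lemma main_est {α : ℝ} (hα : 0 < α) : ∃ K : ℝ, 0 ≤ K ∧ ∀ (y ε q A : ℝ) (Q Q0 : ℂ → ℂ),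
    1 ≤ y → 0 ≤ ε → 0 ≤ q → q ≤ 1 → 0 ≤ A → Differentiable ℂ Q → Differentiable ℂ Q0 →
    (∀ s θ : ℝ, 0 ≤ θ → θ ≤ Real.pi / 6 →
      ‖Q (s + θ * Complex.I)‖ ≤ A * (1 + q * |s|) * Real.exp (α * s)) →
    (∀ s θ : ℝ, 0 ≤ θ → θ ≤ Real.pi / 6 →
      ‖Q (s + θ * Complex.I) - Q0 (s + θ * Complex.I)‖ ≤
        A * (1 + q * |s|) * (ε * Real.exp (2 * α * s))) →
    ‖(∫ s : ℝ, Gfun y Q s) - ∫ s : ℝ, ker y (s + (Real.pi / 6 : ℝ) * Complex.I) *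
        Q0 (s + (Real.pi / 6 : ℝ) * Complex.I)‖ ≤
      K * A * (1 + q * Real.log y) * y ^ (-(1 + α)) * (1 / y ^ 2 + ε) := by
  refine ⟨(∫ s : ℝ, envl (3 + α) s) + ∫ s : ℝ, envl (1 + 2 * α) s,
    add_nonneg (integral_nonneg (envl_nonneg _)) (integral_nonneg (envl_nonneg _)), ?_⟩
  intro y ε q A Q Q0 hy hε hq hq1 hA hQd hQ0d hQ hQ0
  have hy0 : 0 < y := by linarith
  have hpi : (0:ℝ) ≤ Real.pi / 6 := by positivity
  have hl : 0 ≤ Real.log y := Real.log_nonneg hy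
  have hshift := shift_line (Gfun y Q) (Gfun_diff y hQd) (1 + α) (A * Real.exp 1) (by linarith) 0
    (Real.pi / 6) hpi (fun s θ h0 h1 => norm_Gfun_le hy0.le hq1 hA h0 h1 (hQ s θ h0 h1))
  have h00 : ∀ s : ℝ, (s + ((0:ℝ):ℂ) * Complex.I : ℂ) = s := by intro s; simp
  simp only [h00] at hshift
  rw [hshift]
  set Θ : ℝ := Real.pi / 6 with hΘ
  have hGint : Integrable (fun s : ℝ => Gfun y Q (s + Θ * Complex.I)) := by
    have hc := (Gfun_diff y hQd).continuous
    refine Integrable.mono' ((integrable_envl (a := 1 + α) (by linarith)).const_mul (A * Real.exp 1))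
      (by fun_prop : Continuous fun s : ℝ => Gfun y Q (s + Θ * Complex.I)).aestronglyMeasurable
      (Eventually.of_forall fun s => norm_Gfun_le hy0.le hq1 hA hpi le_rfl (hQ s _ hpi le_rfl))
  obtain ⟨i1, b1⟩ := integral_scaled_le (β := 3 + α) (by linarith) hy hq hq1
  obtain ⟨i2, b2⟩ := integral_scaled_le (β := 1 + 2 * α) (by linarith) hy hq hq1
  set B : ℝ → ℝ := fun s => A * ((1 + q * |s|) * Real.exp ((3 + α) * s - y * Real.exp s / 2)) +
    A * ε * ((1 + q * |s|) * Real.exp ((1 + 2 * α) * s - y * Real.exp s / 2)) with hB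
  have hBi : Integrable B := (i1.const_mul A).add (i2.const_mul (A * ε))
  have hdb : ∀ s : ℝ, ‖Gfun y Q (s + Θ * Complex.I) -
      ker y (s + Θ * Complex.I) * Q0 (s + Θ * Complex.I)‖ ≤ B s := by
    intro s
    have e0 : Gfun y Q (s + Θ * Complex.I) - ker y (s + Θ * Complex.I) * Q0 (s + Θ * Complex.I)
      = ker y (s + Θ * Complex.I) * ((Complex.exp (-Complex.exp (2 * (s + Θ * Complex.I)) / 2) - 1)
        * Q (s + Θ * Complex.I) + (Q (s + Θ * Complex.I) - Q0 (s + Θ * Complex.I))) := by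
      unfold Gfun; ring
    rw [e0, norm_mul, norm_ker]
    have e1 : Real.exp (s - y * (Real.exp s * Real.sin Θ)) = Real.exp s * Real.exp (- y * Real.exp s / 2) := by
      rw [hΘ, Real.sin_pi_div_six, ← Real.exp_add]; congr 1; ring
    have e2 : ‖Complex.exp (-Complex.exp (2 * (s + Θ * Complex.I)) / 2) - 1‖ ≤ Real.exp (2 * s) := by
      refine (norm_exp_sub_one_le' ?_).trans ?_
      · rw [gfac_re]
        have := mul_nonneg (Real.exp_pos (2 * s)).le
          (le_trans (by norm_num) (cos2_ge (θ := Θ) hpi le_rfl))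
        linarith
      · rw [norm_div, norm_neg, Complex.norm_exp]
        simp
        linarith
    have e3 := norm_add_le ((Complex.exp (-Complex.exp (2 * (s + Θ * Complex.I)) / 2) - 1)
        * Q (s + Θ * Complex.I)) (Q (s + Θ * Complex.I) - Q0 (s + Θ * Complex.I))
    rw [norm_mul] at e3
    have e4 := hQ s Θ hpi le_rfl
    have e5 := hQ0 s Θ hpi le_rfl
    rw [e1]
    calc _ ≤ Real.exp s * Real.exp (- y * Real.exp s / 2) *
          (Real.exp (2 * s) * (A * (1 + q * |s|) * Real.exp (α * s)) +
            A * (1 + q * |s|) * (ε * Real.exp (2 * α * s))) := by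
          gcongr
          refine e3.trans ?_
          gcongr
      _ = A * ((1 + q * |s|) * (Real.exp s * Real.exp (- y * Real.exp s / 2) * Real.exp (2 * s) * Real.exp (α * s)))
        + A * ε * ((1 + q * |s|) * (Real.exp s * Real.exp (- y * Real.exp s / 2) * Real.exp (2 * α * s))) := by
          ring
      _ = B s := by
          simp only [hB, ← Real.exp_add]
          ring_nf
  have hKc : Continuous (fun s : ℝ => ker y (s + Θ * Complex.I) * Q0 (s + Θ * Complex.I)) := by
    have := (ker_diff y).continuous
    have := hQ0d.continuous
    fun_prop
  have hGc : Continuous (fun s : ℝ => Gfun y Q (s + Θ * Complex.I)) := by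
    have := (Gfun_diff y hQd).continuous
    fun_prop
  have hdi : Integrable (fun s : ℝ => Gfun y Q (s + Θ * Complex.I) -
      ker y (s + Θ * Complex.I) * Q0 (s + Θ * Complex.I)) :=
    Integrable.mono' hBi (hGc.sub hKc).aestronglyMeasurable (Eventually.of_forall hdb)
  have hKi : Integrable (fun s : ℝ => ker y (s + Θ * Complex.I) * Q0 (s + Θ * Complex.I)) := by
    have := hGint.sub hdi
    refine this.congr (Eventually.of_forall fun s => ?_)
    simp
  rw [← integral_sub hGint hKi]
  refine (norm_integral_le_of_norm_le hBi (Eventually.of_forall hdb)).trans ?_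
  simp only [hB]
  rw [integral_add (i1.const_mul A) (i2.const_mul (A * ε)), integral_const_mul, integral_const_mul]
  have hp1 : y ^ (-(3 + α)) = y ^ (-(1 + α)) * (1 / y ^ 2) := by
    rw [show -(3 + α) = -(1 + α) + (-2 : ℝ) by ring, Real.rpow_add hy0, Real.rpow_neg hy0.le 2]
    norm_num
  have hp2 : y ^ (-(1 + 2 * α)) ≤ y ^ (-(1 + α)) :=
    Real.rpow_le_rpow_of_exponent_le hy (by linarith)
  have I1 : 0 ≤ ∫ s : ℝ, envl (3 + α) s := integral_nonneg (envl_nonneg _)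
  have I2 : 0 ≤ ∫ s : ℝ, envl (1 + 2 * α) s := integral_nonneg (envl_nonneg _)
  set J1 := ∫ s : ℝ, envl (3 + α) s
  set J2 := ∫ s : ℝ, envl (1 + 2 * α) s
  have hyp : 0 ≤ y ^ (-(1 + α)) := by positivity
  calc _ ≤ A * (J1 * ((1 + q * Real.log y) * y ^ (-(3 + α)))) +
        A * ε * (J2 * ((1 + q * Real.log y) * y ^ (-(1 + α)))) := by
        gcongr
        refine b2.trans ?_
        gcongr
    _ = A * (1 + q * Real.log y) * y ^ (-(1 + α)) * (J1 * (1 / y ^ 2) + J2 * ε) := by rw [hp1]; ring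
    _ ≤ A * (1 + q * Real.log y) * y ^ (-(1 + α)) * ((J1 + J2) * (1 / y ^ 2 + ε)) := by
        gcongr
        have : 0 ≤ 1 / y ^ 2 := by positivity
        nlinarith [mul_nonneg I1 hε, mul_nonneg I2 this]
    _ = _ := by ring



lemma integrable_gI {a : ℝ} (ha : 0 < a) :
    Integrable (fun s : ℝ => Real.exp (a * s - Real.exp s)) ∧
    Integrable (fun s : ℝ => s * Real.exp (a * s - Real.exp s)) := by
  have h : ∀ s : ℝ, Real.exp (a * s - Real.exp s) ≤ Real.exp (a * s - Real.exp s / 2) := by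
    intro s
    apply Real.exp_le_exp.2
    linarith [Real.exp_pos s]
  constructor
  · refine Integrable.mono' (integrable_envl ha)
      (by fun_prop : Continuous fun s : ℝ => Real.exp (a * s - Real.exp s)).aestronglyMeasurable
      (Eventually.of_forall fun s => ?_)
    rw [Real.norm_of_nonneg (Real.exp_pos _).le]
    unfold envl
    have := abs_nonneg s
    nlinarith [h s, Real.exp_pos (a * s - Real.exp s / 2)]
  · refine Integrable.mono' (integrable_envl ha)
      (by fun_prop : Continuous fun s : ℝ => s * Real.exp (a * s - Real.exp s)).aestronglyMeasurable
      (Eventually.of_forall fun s => ?_)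
    rw [norm_mul, Real.norm_of_nonneg (Real.exp_pos _).le, Real.norm_eq_abs]
    unfold envl
    have := abs_nonneg s
    nlinarith [h s, Real.exp_pos (a * s - Real.exp s / 2)]

lemma Gamma_log {a : ℝ} (ha : 0 < a) :
    ∫ s : ℝ, Real.exp (a * s - Real.exp s) = Real.Gamma a := by
  have h := Complex.Gamma_eq_integral (s := (a : ℂ)) (by simpa using ha)
  rw [Complex.GammaIntegral, integral_exp_subst, Complex.Gamma_ofReal] at h
  have : (∫ s : ℝ, (Real.exp s : ℂ) * (((Real.exp (-Real.exp s) : ℝ) : ℂ) * (Real.exp s : ℂ) ^ ((a:ℂ) - 1)))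
      = ((∫ s : ℝ, Real.exp (a * s - Real.exp s) : ℝ) : ℂ) := by
    rw [← integral_complex_ofReal]
    congr 1; ext s
    rw [show (a : ℂ) - 1 = ((a - 1 : ℝ) : ℂ) by push_cast; rfl,
      ← Complex.ofReal_cpow (Real.exp_pos s).le, ← Real.exp_mul, ← Complex.ofReal_mul,
      ← Complex.ofReal_mul, ← Real.exp_add, ← Real.exp_add]
    congr 2; ring
  rw [this] at h
  exact_mod_cast h.symm

lemma Gamma_log_deriv {a : ℝ} (ha : 0 < a) :
    HasDerivAt Real.Gamma (∫ s : ℝ, s * Real.exp (a * s - Real.exp s)) a := by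
  have h := Complex.hasDerivAt_GammaIntegral (s := (a : ℂ)) (by simpa using ha)
  have h2 : HasDerivAt Complex.Gamma
      (∫ t : ℝ in Ioi 0, (t:ℂ) ^ ((a:ℂ) - 1) * (Real.log t * Real.exp (-t))) (a:ℂ) := by
    refine h.congr_of_eventuallyEq ?_
    have : {z : ℂ | 0 < z.re} ∈ 𝓝 (a : ℂ) :=
      (isOpen_lt continuous_const Complex.continuous_re).mem_nhds (by simpa using ha)
    filter_upwards [this] with z hz
    exact Complex.Gamma_eq_integral hz
  have h3 := h2.real_of_complex
  rw [integral_exp_subst] at h3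
  have : (∫ s : ℝ, (Real.exp s : ℂ) * ((Real.exp s : ℂ) ^ ((a:ℂ) - 1) *
      ((Real.log (Real.exp s) : ℂ) * (Real.exp (-Real.exp s) : ℂ))))
      = ((∫ s : ℝ, s * Real.exp (a * s - Real.exp s) : ℝ) : ℂ) := by
    rw [← integral_complex_ofReal]
    congr 1; ext s
    rw [show (a : ℂ) - 1 = ((a - 1 : ℝ) : ℂ) by push_cast; rfl,
      ← Complex.ofReal_cpow (Real.exp_pos s).le, ← Real.exp_mul, ← Complex.ofReal_mul,
      ← Complex.ofReal_mul, ← Complex.ofReal_mul, Real.log_exp]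
    congr 1
    rw [show a * s - Real.exp s = s + s * (a - 1) + -Real.exp s by ring, Real.exp_add, Real.exp_add]
    ring
  rw [this, Complex.ofReal_re] at h3
  exact h3.congr_of_eventuallyEq (Eventually.of_forall fun x => by simp [Complex.Gamma_ofReal])

lemma scaled_gI {a y : ℝ} (hy : 0 < y) (g : ℝ → ℝ) :
    ∫ s : ℝ, g s * Real.exp (a * s - y * Real.exp s) =
      y ^ (-a) * ∫ s : ℝ, g (s - Real.log y) * Real.exp (a * s - Real.exp s) := by
  rw [← integral_sub_right_eq_self _ (Real.log y), ← integral_const_mul]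
  congr 1; ext s
  rw [Real.exp_sub s, Real.exp_log hy, Real.rpow_def_of_pos hy,
    show a * (s - Real.log y) - y * (Real.exp s / y) = Real.log y * (-a) + (a * s - Real.exp s) by
      field_simp; ring, Real.exp_add]
  ring

lemma sin_ge_half {θ : ℝ} (h0 : Real.pi / 6 ≤ θ) (h1 : θ ≤ Real.pi / 2) : 1 / 2 ≤ Real.sin θ := by
  rw [← Real.sin_pi_div_six]
  exact Real.sin_le_sin_of_le_of_le_pi_div_two (by linarith [Real.pi_pos]) h1 h0

lemma main_shift {α y A : ℝ} (hα : 0 < α) (hy : 1 ≤ y) {R : ℂ → ℂ} (hR : Differentiable ℂ R)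
    (hb : ∀ s θ : ℝ, Real.pi / 6 ≤ θ → θ ≤ Real.pi / 2 →
      ‖R (s + θ * Complex.I)‖ ≤ A * ((1 + |s|) * Real.exp (α * s))) :
    ∫ s : ℝ, ker y (s + (Real.pi / 6 : ℝ) * Complex.I) * R (s + (Real.pi / 6 : ℝ) * Complex.I) =
    ∫ s : ℝ, ker y (s + (Real.pi / 2 : ℝ) * Complex.I) * R (s + (Real.pi / 2 : ℝ) * Complex.I) := by
  refine shift_line (fun ζ => ker y ζ * R ζ) ((ker_diff y).mul hR) (1 + α) A (by linarith) _ _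
    (by linarith [Real.pi_pos]) fun s θ h0 h1 => ?_
  rw [norm_mul, norm_ker]
  have e1 : Real.exp (s - y * (Real.exp s * Real.sin θ)) ≤ Real.exp (s - Real.exp s / 2) := by
    apply Real.exp_le_exp.2
    have h2 := sin_ge_half h0 h1
    have h3 := Real.exp_pos s
    have : Real.exp s * (1 / 2) ≤ Real.exp s * Real.sin θ := by gcongr
    nlinarith
  have h4 := hb s θ h0 h1
  calc _ ≤ Real.exp (s - Real.exp s / 2) * (A * ((1 + |s|) * Real.exp (α * s))) := by gcongr
    _ = A * ((1 + |s|) * (Real.exp (s - Real.exp s / 2) * Real.exp (α * s))) := by ring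
    _ = _ := by
      rw [← Real.exp_add]; unfold envl; ring_nf

lemma ker_half (α y s : ℝ) :
    ker y (s + (Real.pi / 2 : ℝ) * Complex.I) * Complex.exp (α * (s + (Real.pi / 2 : ℝ) * Complex.I)) =
    Complex.exp (((1 + α) * (Real.pi / 2) : ℝ) * Complex.I) *
      ((Real.exp ((1 + α) * s - y * Real.exp s) : ℝ) : ℂ) := by
  unfold ker
  have : Complex.exp (s + (Real.pi / 2 : ℝ) * Complex.I) = Real.exp s * Complex.I := by
    rw [Complex.exp_add, Complex.ofReal_exp]
    congr 1
    rw [show ((Real.pi / 2 : ℝ) : ℂ) = Real.pi / 2 by push_cast; rfl, Complex.exp_pi_div_two_mul_I]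
  rw [this, ← Complex.exp_add, Complex.ofReal_exp ((1 + α) * s - _), ← Complex.exp_add]
  congr 1
  push_cast
  ring_nf
  rw [Complex.I_sq]
  ring

lemma main_zero {α y : ℝ} (hα : 0 < α) (hy : 1 ≤ y) :
    (∫ s : ℝ, ker y (s + (Real.pi / 6 : ℝ) * Complex.I) *
      Complex.exp (α * (s + (Real.pi / 6 : ℝ) * Complex.I))).re =
    -(y ^ (-(1 + α)) * (Real.Gamma (1 + α) * Real.sin (Real.pi * α / 2))) := by
  rw [main_shift (A := 1) hα hy (R := fun ζ => Complex.exp (α * ζ)) (by fun_prop)]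
  · simp only [ker_half]
    rw [integral_const_mul, integral_complex_ofReal, Complex.re_mul_ofReal]
    have h := scaled_gI (a := 1 + α) (y := y) (by linarith) (fun _ => 1)
    simp only [one_mul] at h
    rw [h, Gamma_log (by linarith), Complex.exp_ofReal_mul_I_re,
      show (1 + α) * (Real.pi / 2) = Real.pi * α / 2 + Real.pi / 2 by ring, Real.cos_add_pi_div_two]
    ring
  · intro s θ _ _
    rw [Complex.norm_exp]
    simp
    have := abs_nonneg s
    nlinarith [Real.exp_pos (α * s)]

lemma main_one {α y : ℝ} (hα : 0 < α) (hy : 1 ≤ y) :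
    (∫ s : ℝ, ker y (s + (Real.pi / 6 : ℝ) * Complex.I) *
      ((s + (Real.pi / 6 : ℝ) * Complex.I) *
      Complex.exp (α * (s + (Real.pi / 6 : ℝ) * Complex.I)))).re =
    -(y ^ (-(1 + α)) * (deriv Real.Gamma (1 + α) * Real.sin (Real.pi * α / 2) +
      Real.Gamma (1 + α) * (Real.pi / 2 * Real.cos (Real.pi * α / 2)) -
      Real.log y * (Real.Gamma (1 + α) * Real.sin (Real.pi * α / 2)))) := by
  have hy0 : 0 < y := by linarith
  rw [main_shift (A := 3) hα hy (R := fun ζ => ζ * Complex.exp (α * ζ)) (by fun_prop)]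
  · have key : ∀ s : ℝ, ker y (s + (Real.pi / 2 : ℝ) * Complex.I) *
      ((s + (Real.pi / 2 : ℝ) * Complex.I) * Complex.exp (α * (s + (Real.pi / 2 : ℝ) * Complex.I))) =
      Complex.exp (((1 + α) * (Real.pi / 2) : ℝ) * Complex.I) *
      (((s * Real.exp ((1 + α) * s - y * Real.exp s) : ℝ) : ℂ) + Complex.I *
        ((Real.pi / 2 * Real.exp ((1 + α) * s - y * Real.exp s) : ℝ) : ℂ)) := by
      intro s
      rw [mul_left_comm, ker_half]; push_cast; ring
    simp only [key]
    obtain ⟨i0, i1⟩ := integrable_gI (a := 1 + α) (by linarith)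
    have hle : ∀ s : ℝ, Real.exp ((1 + α) * s - y * Real.exp s) ≤ Real.exp ((1 + α) * s - Real.exp s) := by
      intro s
      apply Real.exp_le_exp.2
      nlinarith [Real.exp_pos s]
    have j0 : Integrable (fun s : ℝ => Real.exp ((1 + α) * s - y * Real.exp s)) := by
      refine i0.mono' (by fun_prop : Continuous fun s : ℝ => Real.exp ((1 + α) * s - y * Real.exp s)).aestronglyMeasurable
        (Eventually.of_forall fun s => ?_)
      rw [Real.norm_of_nonneg (Real.exp_pos _).le]; exact hle s
    have j1 : Integrable (fun s : ℝ => s * Real.exp ((1 + α) * s - y * Real.exp s)) := by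
      refine i1.mono (by fun_prop : Continuous fun s : ℝ => s * Real.exp ((1 + α) * s - y * Real.exp s)).aestronglyMeasurable
        (Eventually.of_forall fun s => ?_)
      rw [norm_mul, norm_mul, Real.norm_of_nonneg (Real.exp_pos _).le, Real.norm_of_nonneg (Real.exp_pos _).le]
      exact mul_le_mul_of_nonneg_left (hle s) (norm_nonneg _)
    rw [integral_const_mul, integral_add j1.ofReal ((j0.const_mul _).ofReal.const_mul _),
      integral_const_mul, integral_complex_ofReal, integral_complex_ofReal, integral_const_mul]
    have h0 := scaled_gI (a := 1 + α) hy0 (fun _ => 1)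
    simp only [one_mul] at h0
    have h1 := scaled_gI (a := 1 + α) hy0 (fun s => s)
    simp only [sub_mul] at h1
    rw [integral_sub i1 (i0.const_mul _), integral_const_mul] at h1
    rw [h0, h1, Gamma_log (by linarith), (Gamma_log_deriv (a := 1 + α) (by linarith)).deriv]
    rw [Complex.mul_re, Complex.exp_ofReal_mul_I_re, Complex.exp_ofReal_mul_I_im,
      show (1 + α) * (Real.pi / 2) = Real.pi * α / 2 + Real.pi / 2 by ring, Real.cos_add_pi_div_two,
      Real.sin_add_pi_div_two]
    simp
    ring
  · intro s θ h0 h1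
    rw [norm_mul, Complex.norm_exp]
    simp
    have h2 : ‖(s + θ * Complex.I : ℂ)‖ ≤ |s| + |θ| := by
      refine (norm_add_le _ _).trans ?_
      simp
    have h3 : |θ| ≤ 3 := by
      rw [abs_of_nonneg (by linarith [Real.pi_pos])]
      linarith [Real.pi_lt_four]
    have h4 : ‖(s + θ * Complex.I : ℂ)‖ ≤ 3 * (1 + |s|) := by linarith [abs_nonneg s]
    nlinarith [Real.exp_pos (α * s)]

lemma cAlpha_eq {a : ℝ} (h0 : 0 < a) (h2 : a < 2) :
    cAlpha a = Real.Gamma (1 + a) * Real.sin (Real.pi * a / 2) / Real.pi := by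
  unfold cAlpha
  split_ifs with h
  · subst h
    norm_num [Real.Gamma_two]
  · have hc : Real.cos (Real.pi * a / 2) ≠ 0 := by
      rcases lt_or_gt_of_ne h with h1 | h1
      · exact (Real.cos_pos_of_mem_Ioo ⟨by nlinarith [Real.pi_pos], by nlinarith [Real.pi_pos]⟩).ne'
      · exact (Real.cos_neg_of_pi_div_two_lt_of_lt (by nlinarith [Real.pi_pos])
          (by nlinarith [Real.pi_pos])).ne
    have hG2 : Real.Gamma (2 - a) ≠ 0 := (Real.Gamma_pos_of_pos (by linarith)).ne'
    have e1 : Real.Gamma (2 - a) = (1 - a) * Real.Gamma (1 - a) := by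
      rw [← Real.Gamma_add_one (sub_ne_zero.2 (Ne.symm h))]; ring_nf
    have e2 : Real.Gamma (1 + a) = a * Real.Gamma a := by
      rw [add_comm, Real.Gamma_add_one h0.ne']
    have e3 := Real.Gamma_mul_Gamma_one_sub a
    have e4 : Real.sin (Real.pi * a) = 2 * Real.sin (Real.pi * a / 2) * Real.cos (Real.pi * a / 2) := by
      rw [← Real.sin_two_mul]; ring_nf
    have hs : Real.sin (Real.pi * a / 2) ≠ 0 :=
      (Real.sin_pos_of_pos_of_lt_pi (by positivity) (by nlinarith [Real.pi_pos])).ne'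
    have hs' : Real.sin (Real.pi * a) ≠ 0 := by rw [e4]; positivity
    rw [eq_div_iff hs', e4] at e3
    rw [div_eq_div_iff (by positivity) Real.pi_ne_zero, e1, e2]
    linear_combination (-(a * (1 - a))) * e3

lemma cAlpha_pos {a : ℝ} (h0 : 0 < a) (h2 : a < 2) : 0 < cAlpha a := by
  rw [cAlpha_eq h0 h2]
  have := Real.Gamma_pos_of_pos (s := 1 + a) (by linarith)
  have := Real.sin_pos_of_pos_of_lt_pi (x := Real.pi * a / 2) (by positivity) (by nlinarith [Real.pi_pos])
  positivity

lemma cAlpha_deriv {a : ℝ} (h0 : 0 < a) (h2 : a < 2) :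
    deriv cAlpha a = (deriv Real.Gamma (1 + a) * Real.sin (Real.pi * a / 2) +
      Real.Gamma (1 + a) * (Real.pi / 2 * Real.cos (Real.pi * a / 2))) / Real.pi := by
  have hev : cAlpha =ᶠ[𝓝 a] fun a => Real.Gamma (1 + a) * Real.sin (Real.pi * a / 2) / Real.pi := by
    filter_upwards [isOpen_Ioo.mem_nhds (⟨h0, h2⟩ : a ∈ Ioo (0:ℝ) 2)] with x hx
    exact cAlpha_eq hx.1 hx.2
  rw [hev.deriv_eq]
  have hG := Gamma_log_deriv (a := 1 + a) (by linarith)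
  have hG' := hG.comp a ((hasDerivAt_id a).const_add 1)
  have hs : HasDerivAt (fun a : ℝ => Real.sin (Real.pi * a / 2))
      (Real.cos (Real.pi * a / 2) * (Real.pi * 1 / 2)) a :=
    (((hasDerivAt_id a).const_mul Real.pi).div_const 2).sin
  have := ((hG'.mul hs).div_const Real.pi).deriv
  rw [hG.deriv]
  refine Eq.trans ?_ (this.trans ?_)
  · rfl
  · simp only [Function.comp]; ring



def Tq (q : ℝ → ℝ) (y : ℝ) : ℝ :=
  (2 * Real.pi)⁻¹ * ∫ u : ℝ, Real.cos (y * u) * (Real.exp (-(u ^ 2) / 2) * q |u|)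

def qH (α ε t : ℝ) : ℝ := t ^ α * Real.exp (-(ε * t ^ α))
def qL (α ε t : ℝ) : ℝ := t ^ α * Real.log t * Real.exp (-(ε * t ^ α))
def qf (α ε t : ℝ) : ℝ := Real.exp (-(ε * t ^ α))

def FH (α ε y : ℝ) : ℝ := Tq (qH α ε) y
def FL (α ε y : ℝ) : ℝ := Tq (qL α ε) y
def Ff (α ε y : ℝ) : ℝ := Tq (qf α ε) y

lemma Tq_measurable {q : ℝ → ℝ} (hq : Measurable q) : Measurable (Tq q) := by
  unfold Tq
  have : StronglyMeasurable (fun y : ℝ => ∫ u : ℝ, Real.cos (y * u) * (Real.exp (-(u ^ 2) / 2) * q |u|)) := by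
    apply StronglyMeasurable.integral_prod_right (f := fun (y : ℝ) (u : ℝ) => Real.cos (y * u) * (Real.exp (-(u ^ 2) / 2) * q |u|))
    apply Measurable.stronglyMeasurable
    unfold Function.uncurry
    fun_prop
  exact this.measurable.const_mul _

lemma qH_meas (α ε : ℝ) : Measurable (qH α ε) := by unfold qH; fun_prop
lemma qL_meas (α ε : ℝ) : Measurable (qL α ε) := by
  unfold qL
  have := Real.measurable_log
  fun_prop
lemma qf_meas (α ε : ℝ) : Measurable (qf α ε) := by unfold qf; fun_prop

lemma Tq_even (q : ℝ → ℝ) (y : ℝ) : Tq q |y| = Tq q y := by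
  unfold Tq
  rcases abs_cases y with ⟨h, _⟩ | ⟨h, _⟩ <;> rw [h]
  simp

lemma Tq_eq {q : ℝ → ℝ} {Q : ℂ → ℂ} {y : ℝ} (hInt0 : Integrable fun s : ℝ => Gfun y Q s)
    (hq : ∀ s : ℝ, Q s = (q (Real.exp s) : ℂ)) :
    Tq q y = Real.pi⁻¹ * (∫ s : ℝ, Gfun y Q s).re := by
  unfold Tq
  have h1 : (∫ u : ℝ, Real.cos (y * u) * (Real.exp (-(u ^ 2) / 2) * q |u|)) =
      ∫ u : ℝ, (fun t => Real.cos (y * t) * (Real.exp (-(t ^ 2) / 2) * q t)) |u| := by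
    congr 1; ext u
    simp only [sq_abs]
    congr 1
    rcases abs_cases u with ⟨h, _⟩ | ⟨h, _⟩ <;> rw [h]
    simp
  rw [h1, integral_comp_abs (f := fun t => Real.cos (y * t) * (Real.exp (-(t ^ 2) / 2) * q t))]
  have h2 := integral_image_eq_integral_abs_deriv_smul (s := univ) (f := Real.exp) (f' := Real.exp)
    MeasurableSet.univ (fun x _ => (Real.hasDerivAt_exp x).hasDerivWithinAt)
    Real.exp_injective.injOn (fun t => Real.cos (y * t) * (Real.exp (-(t ^ 2) / 2) * q t))
  rw [image_univ, Real.range_exp, setIntegral_univ] at h2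
  rw [h2]
  have h3 := integral_re hInt0
  have h3' : (∫ s : ℝ, (Gfun y Q s).re) = (∫ s : ℝ, Gfun y Q s).re := by simpa using h3
  rw [← h3']
  have h4 : ∀ s : ℝ, |Real.exp s| • (Real.cos (y * Real.exp s) * (Real.exp (-(Real.exp s ^ 2) / 2) * q (Real.exp s)))
      = (Gfun y Q s).re := by
    intro s
    unfold Gfun ker
    rw [hq s]
    have e1 : Complex.exp (Complex.I * y * Complex.exp s + s) =
        (Real.exp s : ℂ) * Complex.exp (((y * Real.exp s : ℝ) : ℂ) * Complex.I) := by
      rw [Complex.exp_add]; push_cast; rw [mul_comm]; congr 2; ring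
    have e2 : Complex.exp (-Complex.exp (2 * s) / 2) = ((Real.exp (-(Real.exp s ^ 2) / 2) : ℝ) : ℂ) := by
      push_cast
      rw [← Complex.exp_nat_mul]
      push_cast; rfl
    rw [e1, e2, Complex.re_mul_ofReal, Complex.re_mul_ofReal, Complex.re_ofReal_mul,
      Complex.exp_ofReal_mul_I_re, abs_of_pos (Real.exp_pos s)]
    simp only [smul_eq_mul]
    ring
  simp only [h4]
  have := Real.pi_ne_zero
  field_simp

lemma strip_facts {α : ℝ} (hα : 0 < α) (hα2 : α < 2) {ε : ℝ} (hε : 0 ≤ ε) {s θ : ℝ} (h0 : 0 ≤ θ)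
    (h1 : θ ≤ Real.pi / 6) :
    (-(ε * Complex.exp (α * (s + θ * Complex.I)))).re ≤ 0 ∧
    ‖-(ε * Complex.exp (α * (s + θ * Complex.I)))‖ = ε * Real.exp (α * s) ∧
    ‖Complex.exp (α * (s + θ * Complex.I))‖ = Real.exp (α * s) ∧
    ‖(s + θ * Complex.I : ℂ)‖ ≤ 1 + |s| := by
  have e : (α * (s + θ * Complex.I) : ℂ) = ((α * s : ℝ) : ℂ) + ((α * θ : ℝ) : ℂ) * Complex.I := by
    push_cast; ring
  have hn : ‖Complex.exp (α * (s + θ * Complex.I))‖ = Real.exp (α * s) := by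
    rw [Complex.norm_exp]; simp
  refine ⟨?_, ?_, hn, ?_⟩
  · rw [Complex.neg_re, Complex.re_ofReal_mul, e, cexp_re]
    have : 0 ≤ Real.cos (α * θ) := by
      apply Real.cos_nonneg_of_mem_Icc
      constructor
      · have := mul_nonneg hα.le h0; linarith [Real.pi_pos]
      · have := Real.pi_pos; nlinarith
    have := mul_nonneg hε (mul_nonneg (Real.exp_pos (α * s)).le this)
    linarith
  · rw [norm_neg, norm_mul, hn]; simp [abs_of_nonneg hε]
  · refine (norm_add_le _ _).trans ?_
    simp
    rw [abs_of_nonneg h0]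
    linarith [Real.pi_lt_four]

/-- one lemma giving both the uniform bound and the tail estimate -/
lemma Tq_bounds {α : ℝ} (hα : 0 < α) : ∃ K : ℝ, 0 ≤ K ∧ ∀ (ε p A : ℝ) (q : ℝ → ℝ) (Q Q0 : ℂ → ℂ),
    0 ≤ ε → 0 ≤ p → p ≤ 1 → 0 ≤ A → Differentiable ℂ Q → Differentiable ℂ Q0 →
    (∀ s : ℝ, Q s = (q (Real.exp s) : ℂ)) →
    (∀ s θ : ℝ, 0 ≤ θ → θ ≤ Real.pi / 6 →
      ‖Q (s + θ * Complex.I)‖ ≤ A * (1 + p * |s|) * Real.exp (α * s)) →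
    (∀ s θ : ℝ, 0 ≤ θ → θ ≤ Real.pi / 6 →
      ‖Q (s + θ * Complex.I) - Q0 (s + θ * Complex.I)‖ ≤
        A * (1 + p * |s|) * (ε * Real.exp (2 * α * s))) →
    (∀ y, 0 < y → |Tq q y| ≤ K * A) ∧
    (∀ y, 1 ≤ y → |Tq q y - Real.pi⁻¹ * (∫ s : ℝ, ker y (s + (Real.pi / 6 : ℝ) * Complex.I) *
        Q0 (s + (Real.pi / 6 : ℝ) * Complex.I)).re| ≤
      K * A * (1 + p * Real.log y) * y ^ (-(1 + α)) * (1 / y ^ 2 + ε)) := by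
  obtain ⟨K, hK, hest⟩ := main_est hα
  have hpi := Real.pi_pos
  have hI : 0 ≤ ∫ s : ℝ, envl (1 + α) s := integral_nonneg (envl_nonneg _)
  refine ⟨Real.pi⁻¹ * K + Real.pi⁻¹ * (Real.exp 1 * ∫ s : ℝ, envl (1 + α) s), by positivity, ?_⟩
  intro ε p A q Q Q0 hε hp hp1 hA hQd hQ0d hq hQ hQ0
  have hb : ∀ y, 0 < y → ∀ s : ℝ, ‖Gfun y Q s‖ ≤ (A * Real.exp 1) * envl (1 + α) s := by
    intro y hy s
    have h := norm_Gfun_le (s := s) (θ := 0) hy.le hp1 hA le_rfl (by positivity) (hQ s 0 le_rfl (by positivity))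
    simpa using h
  have hInt0 : ∀ y, 0 < y → Integrable fun s : ℝ => Gfun y Q s := by
    intro y hy
    have hc := (Gfun_diff y hQd).continuous
    exact Integrable.mono' ((integrable_envl (a := 1 + α) (by linarith)).const_mul (A * Real.exp 1))
      (by fun_prop : Continuous fun s : ℝ => Gfun y Q s).aestronglyMeasurable
      (Eventually.of_forall (hb y hy))
  constructor
  · intro y hy
    rw [Tq_eq (hInt0 y hy) hq, abs_mul, abs_of_pos (inv_pos.2 hpi)]
    have h1 := (Complex.abs_re_le_norm (∫ s : ℝ, Gfun y Q s)).trans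
      (norm_integral_le_of_norm_le ((integrable_envl (a := 1 + α) (by linarith)).const_mul (A * Real.exp 1))
      (Eventually.of_forall (hb y hy)))
    rw [integral_const_mul] at h1
    have h2 : 0 ≤ Real.pi⁻¹ * K * A := by positivity
    have h3 := mul_le_mul_of_nonneg_left h1 (inv_pos.2 hpi).le
    linarith
  · intro y hy
    have hy0 : 0 < y := by linarith
    rw [Tq_eq (hInt0 y hy0) hq, ← mul_sub, abs_mul, abs_of_pos (inv_pos.2 hpi), ← Complex.sub_re]
    have h1 := (Complex.abs_re_le_norm _).trans
      (hest y ε p A Q Q0 hy hε hp hp1 hA hQd hQ0d hQ hQ0)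
    have h3 := mul_le_mul_of_nonneg_left h1 (inv_pos.2 hpi).le
    have hl := Real.log_nonneg hy
    have h4 : 0 ≤ (Real.pi⁻¹ * (Real.exp 1 * ∫ s : ℝ, envl (1 + α) s)) * A * (1 + p * Real.log y) * y ^ (-(1 + α)) * (1 / y ^ 2 + ε) := by
      positivity
    linarith

lemma rexp_cast (α s : ℝ) : ((Real.exp s ^ α : ℝ) : ℂ) = Complex.exp (α * s) := by
  rw [← Real.exp_mul]; push_cast; congr 1; ring

lemma integrable_gexp : Integrable (fun u : ℝ => Real.exp (-(u ^ 2) / 2)) := by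
  have := integrable_exp_neg_mul_sq (b := 1/2) (by norm_num)
  refine this.congr (Eventually.of_forall fun u => ?_)
  simp only; congr 1; ring

lemma cexp_gauss (t : ℝ) : ∫ x : ℝ, Complex.exp ((t * x : ℝ) * Complex.I) * (Real.exp (-(x ^ 2) / 2) : ℝ) =
    ((Real.sqrt (2 * Real.pi) * Real.exp (-(t ^ 2) / 2) : ℝ) : ℂ) := by
  have h := fourierIntegral_gaussian (b := 1 / 2) (by norm_num) (t : ℂ)
  have e : (Real.pi / (1 / 2) : ℂ) ^ (1 / 2 : ℂ) = (Real.sqrt (2 * Real.pi) : ℝ) := by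
    rw [Real.sqrt_eq_rpow, Complex.ofReal_cpow (by positivity)]
    push_cast; congr 1; ring
  rw [e] at h
  push_cast
  convert h using 2
  · ext x
    congr 1
    · congr 1; ring
    · congr 1; ring
  · congr 1; ring

lemma integrable_cexp_gauss (t : ℝ) : Integrable fun x : ℝ =>
    Complex.exp ((t * x : ℝ) * Complex.I) * (Real.exp (-(x ^ 2) / 2) : ℝ) := by
  refine integrable_gexp.mono' (by fun_prop : Continuous _).aestronglyMeasurable (Eventually.of_forall fun u => ?_)
  rw [norm_mul, Complex.norm_exp_ofReal_mul_I, one_mul, Complex.norm_real, Real.norm_of_nonneg (Real.exp_pos _).le]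

lemma cos_gauss (t : ℝ) : ∫ x : ℝ, Real.cos (t * x) * Real.exp (-(x ^ 2) / 2) =
    Real.sqrt (2 * Real.pi) * Real.exp (-(t ^ 2) / 2) := by
  have h := congrArg Complex.re (cexp_gauss t)
  have h3 : (∫ x : ℝ, (Complex.exp ((t * x : ℝ) * Complex.I) * (Real.exp (-(x ^ 2) / 2) : ℝ)).re) = _ := integral_re (integrable_cexp_gauss t)
  rw [Complex.ofReal_re] at h
  rw [← h]
  refine Eq.trans ?_ h3
  congr 1; ext x
  rw [Complex.re_mul_ofReal, Complex.exp_ofReal_mul_I_re]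

lemma sin_gauss (t : ℝ) : ∫ x : ℝ, Real.sin (t * x) * Real.exp (-(x ^ 2) / 2) = 0 := by
  have h := congrArg Complex.im (cexp_gauss t)
  have h3 : (∫ x : ℝ, (Complex.exp ((t * x : ℝ) * Complex.I) * (Real.exp (-(x ^ 2) / 2) : ℝ)).im) = _ := integral_im (integrable_cexp_gauss t)
  rw [Complex.ofReal_im] at h
  rw [← h]
  refine Eq.trans ?_ h3
  congr 1; ext x
  rw [Complex.im_mul_ofReal, Complex.exp_ofReal_mul_I_im]

lemma gauss_eq (y : ℝ) : (2 * Real.pi)⁻¹ * ∫ u : ℝ, Real.cos (y * u) * Real.exp (-(u ^ 2) / 2) = gauss y := by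
  rw [cos_gauss]
  unfold gauss
  have h := Real.pi_pos
  have h2 : Real.sqrt (2 * Real.pi) ^ 2 = 2 * Real.pi := Real.sq_sqrt (by positivity)
  have h3 : Real.sqrt (2 * Real.pi) ≠ 0 := by positivity
  generalize Real.sqrt (2 * Real.pi) = r at h2 h3 ⊢
  rw [← h2]
  field_simp

lemma Ff_sub {α ε : ℝ} (hε : 0 ≤ ε) (y : ℝ) :
    Ff α ε y - gauss y = Tq (fun t => Real.exp (-(ε * t ^ α)) - 1) y := by
  rw [← gauss_eq]
  unfold Ff Tq qf
  have hi : Integrable (fun u : ℝ => Real.exp (-(u ^ 2) / 2)) := by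
    have := integrable_exp_neg_mul_sq (b := 1/2) (by norm_num)
    refine this.congr (Eventually.of_forall fun u => ?_)
    simp only; congr 1; ring
  have i1 : Integrable (fun u : ℝ => Real.cos (y * u) * Real.exp (-(u ^ 2) / 2)) := by
    refine hi.mono' (by fun_prop : Continuous _).aestronglyMeasurable (Eventually.of_forall fun u => ?_)
    rw [norm_mul, Real.norm_of_nonneg (Real.exp_pos _).le, Real.norm_eq_abs]
    exact mul_le_of_le_one_left (Real.exp_pos _).le (Real.abs_cos_le_one _)
  have i2 : Integrable (fun u : ℝ => Real.cos (y * u) * (Real.exp (-(u ^ 2) / 2) * Real.exp (-(ε * |u| ^ α)))) := by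
    refine hi.mono' (by fun_prop : Measurable _).aestronglyMeasurable (Eventually.of_forall fun u => ?_)
    rw [norm_mul, norm_mul, Real.norm_of_nonneg (Real.exp_pos _).le, Real.norm_of_nonneg (Real.exp_pos _).le, Real.norm_eq_abs]
    have h1 : Real.exp (-(ε * |u| ^ α)) ≤ 1 := by
      apply Real.exp_le_one_iff.2
      have : 0 ≤ ε * |u| ^ α := by positivity
      linarith
    calc _ ≤ 1 * (Real.exp (-(u ^ 2) / 2) * 1) := by
          gcongr
          exact Real.abs_cos_le_one _
      _ = _ := by ring
  rw [← mul_sub, ← integral_sub i2 i1]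
  congr 2; ext u; ring

theorem tail_facts {α : ℝ} (hα : 0 < α) (hα2 : α < 2) : ∃ C : ℝ, 0 < C ∧ ∀ ε, 0 ≤ ε →
    (∀ y, 0 < y → |FH α ε y| ≤ C ∧ |FL α ε y| ≤ C ∧ |Ff α ε y - gauss y| ≤ C * ε) ∧
    (∀ y, 1 ≤ y →
      |FH α ε y + cAlpha α * y ^ (-(1 + α))| ≤ C * y ^ (-(1 + α)) * (1 / y ^ 2 + ε) ∧
      |FL α ε y + (deriv cAlpha α - cAlpha α * Real.log y) * y ^ (-(1 + α))| ≤
        C * (1 + Real.log y) * y ^ (-(1 + α)) * (1 / y ^ 2 + ε) ∧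
      |Ff α ε y - gauss y - ε * (cAlpha α * y ^ (-(1 + α)))| ≤
        C * ε * y ^ (-(1 + α)) * (1 / y ^ 2 + ε)) := by
  obtain ⟨K, hK, hB⟩ := Tq_bounds hα
  refine ⟨3 * K + 1, by positivity, ?_⟩
  intro ε hε
  have hpi := Real.pi_pos
  obtain ⟨H1, H2⟩ := hB ε 0 2 (qH α ε)
    (fun ζ => Complex.exp (α * ζ) * Complex.exp (-(ε * Complex.exp (α * ζ))))
    (fun ζ => Complex.exp (α * ζ)) hε le_rfl zero_le_one (by norm_num) (by fun_prop) (by fun_prop)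
    (by intro s; unfold qH; push_cast; rw [← rexp_cast])
    (by
      intro s θ h0 h1
      obtain ⟨f1, f2, f3, f4⟩ := strip_facts hα hα2 hε (s := s) h0 h1
      rw [norm_mul, f3, Complex.norm_exp]
      have := Real.exp_le_one_iff.2 f1
      nlinarith [Real.exp_pos (α * s)])
    (by
      intro s θ h0 h1
      obtain ⟨f1, f2, f3, f4⟩ := strip_facts hα hα2 hε (s := s) h0 h1
      have := norm_exp_sub_one_le' f1
      rw [f2] at this
      rw [show ∀ a b : ℂ, a * b - a = a * (b - 1) by intros; ring, norm_mul, f3,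
        show 2 * α * s = α * s + α * s by ring, Real.exp_add]
      calc _ ≤ Real.exp (α * s) * (2 * (ε * Real.exp (α * s))) := by gcongr
        _ = _ := by ring)
  obtain ⟨L1, L2⟩ := hB ε 1 2 (qL α ε)
    (fun ζ => ζ * Complex.exp (α * ζ) * Complex.exp (-(ε * Complex.exp (α * ζ))))
    (fun ζ => ζ * Complex.exp (α * ζ)) hε zero_le_one le_rfl (by norm_num) (by fun_prop) (by fun_prop)
    (by intro s; unfold qL; rw [Real.log_exp]; push_cast; rw [← rexp_cast]; push_cast; ring)
    (by
      intro s θ h0 h1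
      obtain ⟨f1, f2, f3, f4⟩ := strip_facts hα hα2 hε (s := s) h0 h1
      rw [norm_mul, norm_mul, f3, Complex.norm_exp]
      have := Real.exp_le_one_iff.2 f1
      have hs := abs_nonneg s
      calc _ ≤ (1 + |s|) * Real.exp (α * s) * 1 := by gcongr
        _ ≤ _ := by nlinarith [Real.exp_pos (α * s), mul_nonneg hs (Real.exp_pos (α * s)).le])
    (by
      intro s θ h0 h1
      obtain ⟨f1, f2, f3, f4⟩ := strip_facts hα hα2 hε (s := s) h0 h1
      have := norm_exp_sub_one_le' f1
      rw [f2] at this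
      rw [show ∀ a b : ℂ, a * b - a = a * (b - 1) by intros; ring, norm_mul, norm_mul, f3,
        show 2 * α * s = α * s + α * s by ring, Real.exp_add]
      calc _ ≤ (1 + |s|) * Real.exp (α * s) * (2 * (ε * Real.exp (α * s))) := by gcongr
        _ = _ := by ring)
  obtain ⟨G1, G2⟩ := hB ε 0 (3 * ε) (fun t => Real.exp (-(ε * t ^ α)) - 1)
    (fun ζ => Complex.exp (-(ε * Complex.exp (α * ζ))) - 1)
    (fun ζ => -(ε * Complex.exp (α * ζ))) hε le_rfl zero_le_one (by positivity) (by fun_prop) (by fun_prop)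
    (by intro s; push_cast; rw [← rexp_cast])
    (by
      intro s θ h0 h1
      obtain ⟨f1, f2, f3, f4⟩ := strip_facts hα hα2 hε (s := s) h0 h1
      have := norm_exp_sub_one_le' f1
      rw [f2] at this
      refine this.trans ?_
      nlinarith [mul_nonneg hε (Real.exp_pos (α * s)).le])
    (by
      intro s θ h0 h1
      obtain ⟨f1, f2, f3, f4⟩ := strip_facts hα hα2 hε (s := s) h0 h1
      have := norm_exp_sub_one_sub_le' f1
      rw [f2] at this
      refine this.trans (le_of_eq ?_)
      rw [show 2 * α * s = α * s + α * s by ring, Real.exp_add]; ring)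
  refine ⟨fun y hy => ⟨(H1 y hy).trans (by linarith), (L1 y hy).trans (by linarith), ?_⟩, fun y hy => ?_⟩
  · rw [Ff_sub hε]
    refine (G1 y hy).trans ?_
    nlinarith
  · have hy0 : 0 < y := by linarith
    have hl := Real.log_nonneg hy
    have hyp : 0 ≤ y ^ (-(1 + α)) * (1 / y ^ 2 + ε) := by positivity
    have h1 := H2 y hy
    have h2 := L2 y hy
    have h3 := G2 y hy
    have hm : (∫ s : ℝ, ker y (s + (Real.pi / 6 : ℝ) * Complex.I) *
      -(ε * Complex.exp (α * (s + (Real.pi / 6 : ℝ) * Complex.I)))).re =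
      -(ε * (∫ s : ℝ, ker y (s + (Real.pi / 6 : ℝ) * Complex.I) *
      Complex.exp (α * (s + (Real.pi / 6 : ℝ) * Complex.I))).re) := by
      rw [← Complex.re_ofReal_mul, ← integral_const_mul, ← Complex.neg_re, ← integral_neg]
      congr 2; ext s; ring
    rw [main_zero hα hy] at h1
    rw [main_one hα hy] at h2
    rw [hm, main_zero hα hy] at h3
    rw [Ff_sub hε, cAlpha_deriv hα hα2, cAlpha_eq hα hα2]
    have k1 : ∀ {a b c d : ℝ}, |a| ≤ c → a = b → c ≤ d → |b| ≤ d := by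
      intro a b c d h e h'; rw [← e]; exact h.trans h'
    refine ⟨k1 h1 ?_ ?_, k1 h2 ?_ ?_, k1 h3 ?_ ?_⟩
    · unfold FH; field_simp; ring
    · nlinarith [mul_nonneg hK hyp]
    · unfold FL; field_simp; ring
    · have : 0 ≤ (1 + Real.log y) * (y ^ (-(1 + α)) * (1 / y ^ 2 + ε)) := by positivity
      nlinarith [mul_nonneg hK this]
    · field_simp
    · nlinarith [mul_nonneg hε hyp]



lemma integrable_abs_of_Ioi {g : ℝ → ℝ} (hg : IntegrableOn g (Ioi 0)) : Integrable fun u : ℝ => g |u| := by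
  have h1 : IntegrableOn (fun u : ℝ => g |u|) (Ioi 0) :=
    hg.congr_fun (fun x hx => by rw [abs_of_pos hx]) measurableSet_Ioi
  have h2 : IntegrableOn (fun x ↦ g |x|) (Iic 0) := by
    rw [← Measure.map_neg_eq_self (volume : Measure ℝ)]
    let m : MeasurableEmbedding fun x : ℝ => -x := (Homeomorph.neg ℝ).measurableEmbedding
    rw [m.integrableOn_map_iff]
    simp_rw [Function.comp_def, abs_neg, neg_preimage, neg_Iic, neg_zero]
    exact Iff.mpr integrableOn_Ici_iff_integrableOn_Ioi h1
  rw [← integrableOn_univ, ← Iic_union_Ioi (a := (0 : ℝ))]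
  exact h2.union h1

lemma int_pow_exp {α s : ℝ} (hα : 0 < α) (hs : 0 ≤ s) :
    Integrable fun u : ℝ => |u| ^ s * Real.exp (-(|u| ^ α)) := by
  exact integrable_abs_of_Ioi (g := fun u => u ^ s * Real.exp (-(u ^ α)))
    (integrableOn_rpow_mul_exp_neg_rpow (by linarith) hα)

lemma int_exp {α : ℝ} (hα : 0 < α) : Integrable fun u : ℝ => Real.exp (-(|u| ^ α)) := by
  simpa using int_pow_exp hα (le_refl 0)

lemma log_bd {α t : ℝ} (hα : 0 < α) (ht : 0 ≤ t) : |t ^ α * Real.log t| ≤ t ^ (α + 1) + α⁻¹ := by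
  rcases ht.eq_or_lt with rfl | h
  · rw [Real.zero_rpow hα.ne', Real.zero_rpow (by linarith)]; simp; exact hα.le
  · rw [abs_mul, abs_of_pos (Real.rpow_pos_of_pos h _), Real.rpow_add_one h.ne']
    have hp := Real.rpow_pos_of_pos h α
    have h1 := Real.log_le_self ht
    have h2 := Real.log_le_rpow_div (inv_pos.2 h).le hα
    rw [Real.log_inv, Real.inv_rpow ht] at h2
    have h2' : t ^ α * (- Real.log t) ≤ α⁻¹ := by
      refine (mul_le_mul_of_nonneg_left h2 hp.le).trans (le_of_eq ?_)
      field_simp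
    have h4 : 0 < t ^ α * t := by positivity
    have h5 : 0 < α⁻¹ := by positivity
    rcases abs_cases (Real.log t) with ⟨e, _⟩ | ⟨e, _⟩ <;> rw [e]
    · nlinarith
    · nlinarith

lemma int_log {α : ℝ} (hα : 0 < α) :
    Integrable fun u : ℝ => |u| ^ α * Real.log |u| * Real.exp (-(|u| ^ α)) := by
  have hl := Real.measurable_log
  refine ((int_pow_exp hα (s := α + 1) (by linarith)).add ((int_exp hα).const_mul α⁻¹)).mono'
    (by fun_prop : Measurable _).aestronglyMeasurable (Eventually.of_forall fun u => ?_)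
  rw [norm_mul, Real.norm_eq_abs, Real.norm_of_nonneg (Real.exp_pos _).le]
  refine (mul_le_mul_of_nonneg_right (log_bd hα (abs_nonneg u)) (Real.exp_pos _).le).trans (le_of_eq ?_)
  simp only [Pi.add_apply]; ring

lemma gauss_cos (y t : ℝ) : ∫ x : ℝ, gauss x * Real.cos ((y - x) * t) =
    Real.cos (y * t) * Real.exp (-(t ^ 2) / 2) := by
  have ic : Integrable fun x : ℝ => Real.cos (t * x) * Real.exp (-(x ^ 2) / 2) := by
    refine integrable_gexp.mono' (by fun_prop : Continuous _).aestronglyMeasurable (Eventually.of_forall fun u => ?_)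
    rw [norm_mul, Real.norm_of_nonneg (Real.exp_pos _).le, Real.norm_eq_abs]
    exact mul_le_of_le_one_left (Real.exp_pos _).le (Real.abs_cos_le_one _)
  have is : Integrable fun x : ℝ => Real.sin (t * x) * Real.exp (-(x ^ 2) / 2) := by
    refine integrable_gexp.mono' (by fun_prop : Continuous _).aestronglyMeasurable (Eventually.of_forall fun u => ?_)
    rw [norm_mul, Real.norm_of_nonneg (Real.exp_pos _).le, Real.norm_eq_abs]
    exact mul_le_of_le_one_left (Real.exp_pos _).le (Real.abs_sin_le_one _)
  have e : ∀ x : ℝ, gauss x * Real.cos ((y - x) * t) =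
      (Real.sqrt (2 * Real.pi))⁻¹ * Real.cos (y * t) * (Real.cos (t * x) * Real.exp (-(x ^ 2) / 2)) +
      (Real.sqrt (2 * Real.pi))⁻¹ * Real.sin (y * t) * (Real.sin (t * x) * Real.exp (-(x ^ 2) / 2)) := by
    intro x
    unfold gauss
    rw [sub_mul, Real.cos_sub, mul_comm x t]; ring
  simp only [e]
  rw [integral_add (ic.const_mul _) (is.const_mul _), integral_const_mul, integral_const_mul, cos_gauss, sin_gauss]
  have : Real.sqrt (2 * Real.pi) ≠ 0 := by have := Real.pi_pos; positivity
  field_simp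
  ring

lemma integrable_gauss : Integrable gauss := integrable_gexp.const_mul _

lemma gauss_continuous : Continuous gauss := by unfold gauss; fun_prop

lemma conv_fourier {m : ℝ → ℝ} (hm : Integrable m) {w : ℝ} (hw : 0 < w) (y : ℝ) :
    ∫ z : ℝ, gauss (y - w * z) * (∫ u : ℝ, Real.cos (z * u) * m u) =
    ∫ v : ℝ, Real.cos (y * v) * (Real.exp (-(v ^ 2) / 2) * m (w * v)) := by
  have hg : Integrable fun z : ℝ => gauss (y - w * z) :=
    ((integrable_gauss.comp_sub_left y).comp_mul_left' hw.ne')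
  have hgc := gauss_continuous
  have hgp : ∀ x, 0 ≤ gauss x := fun x => by unfold gauss; positivity
  have hInt0 : Integrable (Function.uncurry fun z u : ℝ => gauss (y - w * z) * (Real.cos (z * u) * m u))
      ((volume : Measure ℝ).prod volume) := by
    have h0 := hg.mul_prod hm
    have e : (Function.uncurry fun z u : ℝ => gauss (y - w * z) * (Real.cos (z * u) * m u)) =
      fun p : ℝ × ℝ => Real.cos (p.1 * p.2) * (gauss (y - w * p.1) * m p.2) := by
      ext p; simp only [Function.uncurry]; ring
    rw [e]
    refine h0.bdd_mul (c := 1) (by fun_prop : Continuous _).aestronglyMeasurable (Eventually.of_forall fun p => ?_)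
    exact Real.abs_cos_le_one _
  simp only [← integral_const_mul]
  rw [integral_integral_swap hInt0]
  have inner : ∀ u : ℝ, ∫ z : ℝ, gauss (y - w * z) * (Real.cos (z * u) * m u) =
      w⁻¹ * ((fun v => Real.cos (y * v) * (Real.exp (-(v ^ 2) / 2) * m (w * v))) (w⁻¹ * u)) := by
    intro u
    have h1 := Measure.integral_comp_mul_left (fun x => (fun x => gauss x * Real.cos ((y - x) * (w⁻¹ * u))) (y - x)) w
    rw [integral_sub_left_eq_self (fun x => gauss x * Real.cos ((y - x) * (w⁻¹ * u))) volume y, gauss_cos] at h1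
    have e : ∀ z, gauss (y - w * z) * (Real.cos (z * u) * m u) =
      m u * ((fun x => (fun x => gauss x * Real.cos ((y - x) * (w⁻¹ * u))) (y - x)) (w * z)) := by
      intro z
      have : (y - (y - w * z)) * (w⁻¹ * u) = z * u := by field_simp; ring
      simp only [this]; ring
    simp only [e]
    rw [integral_const_mul, h1, abs_of_pos (inv_pos.2 hw), mul_inv_cancel_left₀ hw.ne']
    simp only [smul_eq_mul]; ring
  simp only [inner]
  rw [integral_const_mul, Measure.integral_comp_mul_left (fun v => Real.cos (y * v) * (Real.exp (-(v ^ 2) / 2) * m (w * v))), inv_inv, abs_of_pos hw, smul_eq_mul, inv_mul_cancel_left₀ hw.ne']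

lemma Dop_stable {α : ℝ} (hα : 0 < α) (z : ℝ) : Dop (stableDensity α) z =
    (2 * Real.pi)⁻¹ * (α * ∫ u : ℝ, Real.cos (z * u) * (|u| ^ α * Real.exp (-(|u| ^ α)))) := by
  have h1 : Integrable fun u : ℝ => |u| * Real.exp (-(|u| ^ α)) := by
    simpa using int_pow_exp hα (zero_le_one)
  have hc : Integrable fun u : ℝ => Real.cos (z * u) * Real.exp (-(|u| ^ α)) :=
    (int_exp hα).bdd_mul (c := 1) (by fun_prop : Continuous _).aestronglyMeasurable
      (Eventually.of_forall fun p => Real.abs_cos_le_one _)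
  have hca : Integrable fun u : ℝ => Real.cos (z * u) * (|u| ^ α * Real.exp (-(|u| ^ α))) :=
    (int_pow_exp hα hα.le).bdd_mul (c := 1) (by fun_prop : Continuous _).aestronglyMeasurable
      (Eventually.of_forall fun p => Real.abs_cos_le_one _)
  obtain ⟨hI, hd⟩ := hasDerivAt_integral_of_dominated_loc_of_deriv_le (μ := volume) (𝕜 := ℝ) (s := univ) (x₀ := z)
    (F := fun z u : ℝ => Real.cos (z * u) * Real.exp (-(|u| ^ α)))
    (F' := fun z u : ℝ => (-Real.sin (z * u) * u) * Real.exp (-(|u| ^ α)))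
    (bound := fun u : ℝ => |u| * Real.exp (-(|u| ^ α)))
    univ_mem
    (Eventually.of_forall fun x => (by fun_prop : Measurable _).aestronglyMeasurable) hc
    (by fun_prop : Measurable _).aestronglyMeasurable
    (Eventually.of_forall fun u x _ => by
      rw [norm_mul, norm_mul, Real.norm_of_nonneg (Real.exp_pos _).le, norm_neg, Real.norm_eq_abs, Real.norm_eq_abs]
      have := Real.abs_sin_le_one (x * u)
      gcongr
      exact mul_le_of_le_one_left (abs_nonneg _) this)
    h1
    (Eventually.of_forall fun u x _ => by
      have : HasDerivAt (fun x : ℝ => Real.cos (x * u)) (-Real.sin (x * u) * u) x := by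
        simpa using (hasDerivAt_mul_const u (x := x)).cos
      exact this.mul_const _)
  have hder : deriv (stableDensity α) z = (2 * Real.pi)⁻¹ * ∫ u : ℝ, (-Real.sin (z * u) * u) * Real.exp (-(|u| ^ α)) :=
    (hd.const_mul _).deriv
  -- integration by parts
  have key : ∫ u : ℝ, (Real.cos (z * u) * Real.exp (-(|u| ^ α)) + z * ((-Real.sin (z * u) * u) * Real.exp (-(|u| ^ α)))
      - α * (Real.cos (z * u) * (|u| ^ α * Real.exp (-(|u| ^ α))))) = 0 := by
    set G : ℝ → ℝ := fun u => (Real.cos (z * u) * Real.exp (-(u ^ α)) + z * ((-Real.sin (z * u) * u) * Real.exp (-(u ^ α)))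
      - α * (Real.cos (z * u) * (u ^ α * Real.exp (-(u ^ α))))) with hG
    have hGi := (hc.add (hI.const_mul z)).sub (hca.const_mul α)
    have e : ∀ u : ℝ, (Real.cos (z * u) * Real.exp (-(|u| ^ α)) + z * ((-Real.sin (z * u) * u) * Real.exp (-(|u| ^ α)))
      - α * (Real.cos (z * u) * (|u| ^ α * Real.exp (-(|u| ^ α))))) = G |u| := by
      intro u
      simp only [hG]
      rcases abs_cases u with ⟨h, _⟩ | ⟨h, _⟩ <;> rw [h]
      simp
    have hGi' : IntegrableOn G (Ioi 0) := by
      have : IntegrableOn (fun u => G |u|) (Ioi 0) := by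
        refine Integrable.integrableOn (hGi.congr (Eventually.of_forall fun u => ?_))
        exact e u
      exact this.congr_fun (fun x hx => by simp only; rw [abs_of_pos hx]) measurableSet_Ioi
    simp only [e]
    rw [integral_comp_abs]
    have := integral_Ioi_of_hasDerivAt_of_tendsto (f := fun u : ℝ => u * Real.cos (z * u) * Real.exp (-(u ^ α)))
      (f' := G) (a := 0) (m := 0) ?_ ?_ hGi' ?_
    · rw [this]; simp
    · have : Continuous fun u : ℝ => u * Real.cos (z * u) * Real.exp (-(u ^ α)) := by
        have := Real.continuous_rpow_const (q := α) hα.le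
        fun_prop
      exact this.continuousWithinAt
    · intro u hu
      have hu0 : (0:ℝ) < u := hu
      have d1 : HasDerivAt (fun u : ℝ => Real.cos (z * u)) (-Real.sin (z * u) * z) u := by
        simpa using (hasDerivAt_const_mul z (x := u)).cos
      have d2 := (Real.hasDerivAt_rpow_const (x := u) (p := α) (Or.inl hu0.ne')).neg.exp
      have d3 := ((hasDerivAt_id u).mul d1).mul d2
      refine d3.congr_deriv ?_
      simp only [hG, id, Pi.neg_apply, Pi.mul_apply]
      have : u ^ α = u * u ^ (α - 1) := by
        rw [Real.rpow_sub_one hu0.ne']; field_simp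
      rw [this]; ring
    · have ht : Tendsto (fun u : ℝ => (u ^ α) ^ (1 / α) * Real.exp (-1 * (u ^ α))) atTop (𝓝 0) :=
        (tendsto_rpow_mul_exp_neg_mul_atTop_nhds_zero (1 / α) 1 one_pos).comp (tendsto_rpow_atTop hα)
      refine squeeze_zero_norm' ?_ ht
      filter_upwards [eventually_ge_atTop 0] with u hu
      rw [norm_mul, norm_mul, Real.norm_of_nonneg (Real.exp_pos _).le, Real.norm_of_nonneg hu, ← Real.rpow_mul hu,
        mul_one_div_cancel hα.ne', Real.rpow_one, neg_one_mul]
      gcongr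
      exact mul_le_of_le_one_right hu (Real.abs_cos_le_one _)
  have hs : Integrable fun u : ℝ => Real.cos (z * u) * Real.exp (-(|u| ^ α)) + z * ((-Real.sin (z * u) * u) * Real.exp (-(|u| ^ α))) :=
    hc.add (hI.const_mul z)
  rw [integral_sub hs (hca.const_mul α), integral_add hc (hI.const_mul z),
    integral_const_mul, integral_const_mul, sub_eq_zero] at key
  rw [← key]
  unfold Dop
  rw [hder]
  unfold stableDensity
  ring

lemma mul_abs_rpow {w v α : ℝ} (hw : 0 < w) : |w * v| ^ α = w ^ α * |v| ^ α := by
  rw [abs_mul, abs_of_pos hw, Real.mul_rpow hw.le (abs_nonneg _)]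

lemma fFun_eq {α w : ℝ} (hα : 0 < α) (hw : 0 < w) (y : ℝ) : fFun α y w = Ff α (w ^ α) y := by
  unfold fFun Ff Tq qf stableDensity
  have h := conv_fourier (int_exp hα) hw y
  simp only [mul_abs_rpow hw] at h
  rw [← h, ← integral_const_mul]
  congr 1; ext z; ring

lemma hFun_eq {α w : ℝ} (hα : 0 < α) (hw : 0 < w) (y : ℝ) : hFun α y w = α * w ^ α * FH α (w ^ α) y := by
  unfold hFun FH Tq qH
  simp only [Dop_stable hα]
  have h := conv_fourier (int_pow_exp hα hα.le) hw y
  simp only [mul_abs_rpow hw] at h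
  have e : ∀ z : ℝ, gauss (y - w * z) * ((2 * Real.pi)⁻¹ * (α * ∫ u : ℝ, Real.cos (z * u) * (|u| ^ α * Real.exp (-(|u| ^ α))))) =
    ((2 * Real.pi)⁻¹ * α) * (gauss (y - w * z) * (∫ u : ℝ, Real.cos (z * u) * (|u| ^ α * Real.exp (-(|u| ^ α))))) := by
    intro z; ring
  simp only [e]
  rw [integral_const_mul, h]
  have e2 : ∀ v : ℝ, Real.cos (y * v) * (Real.exp (-(v ^ 2) / 2) * (w ^ α * |v| ^ α * Real.exp (-(w ^ α * |v| ^ α)))) =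
    w ^ α * (Real.cos (y * v) * (Real.exp (-(v ^ 2) / 2) * (|v| ^ α * Real.exp (-(w ^ α * |v| ^ α))))) := by
    intro v; ring
  simp only [e2]
  rw [integral_const_mul]; ring

lemma exp_le_one' {ε t α : ℝ} (hε : 0 ≤ ε) (ht : 0 ≤ t) : Real.exp (-(ε * t ^ α)) ≤ 1 := by
  apply Real.exp_le_one_iff.2
  have : 0 ≤ ε * t ^ α := by positivity
  linarith

lemma int_abs_gexp (s : ℝ) (hs : 0 ≤ s) : Integrable fun u : ℝ => |u| ^ s * Real.exp (-(u ^ 2) / 2) := by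
  have h := integrableOn_rpow_mul_exp_neg_mul_sq (b := 1 / 2) (by norm_num) (s := s) (by linarith)
  refine (integrable_abs_of_Ioi h).congr (Eventually.of_forall fun u => ?_)
  simp only [sq_abs]; congr 2; ring

lemma int_H {α ε : ℝ} (hα : 0 < α) (hε : 0 ≤ ε) (y : ℝ) : Integrable fun u : ℝ =>
    Real.cos (y * u) * (Real.exp (-(u ^ 2) / 2) * qH α ε |u|) := by
  have hm := qH_meas α ε
  refine (int_abs_gexp α hα.le).mono' (by fun_prop : Measurable _).aestronglyMeasurable (Eventually.of_forall fun u => ?_)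
  unfold qH
  rw [norm_mul, norm_mul, norm_mul, Real.norm_of_nonneg (Real.exp_pos _).le, Real.norm_of_nonneg (Real.exp_pos _).le,
    Real.norm_of_nonneg (by positivity : 0 ≤ |u| ^ α), Real.norm_eq_abs]
  have h1 := exp_le_one' (α := α) hε (abs_nonneg u)
  have h2 := Real.abs_cos_le_one (y * u)
  calc _ ≤ 1 * (Real.exp (-(u ^ 2) / 2) * (|u| ^ α * 1)) := by gcongr
    _ = _ := by ring

lemma int_L {α ε : ℝ} (hα : 0 < α) (hε : 0 ≤ ε) (y : ℝ) : Integrable fun u : ℝ =>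
    Real.cos (y * u) * (Real.exp (-(u ^ 2) / 2) * qL α ε |u|) := by
  have hm := qL_meas α ε
  refine ((int_abs_gexp (α + 1) (by linarith)).add (integrable_gexp.const_mul α⁻¹)).mono' (by fun_prop : Measurable _).aestronglyMeasurable (Eventually.of_forall fun u => ?_)
  unfold qL
  rw [norm_mul, norm_mul, norm_mul, Real.norm_of_nonneg (Real.exp_pos _).le, Real.norm_of_nonneg (Real.exp_pos _).le,
    Real.norm_eq_abs, Real.norm_eq_abs]
  have h1 := exp_le_one' (α := α) hε (abs_nonneg u)
  have h2 := Real.abs_cos_le_one (y * u)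
  have h3 := log_bd hα (abs_nonneg u)
  have : 0 ≤ |u| ^ (α + 1) + α⁻¹ := by positivity
  calc _ ≤ 1 * (Real.exp (-(u ^ 2) / 2) * ((|u| ^ (α + 1) + α⁻¹) * 1)) := by gcongr
    _ = _ := by simp only [Pi.add_apply]; ring

lemma kFun_eq {α w : ℝ} (hα : 0 < α) (hw : 0 < w) (y : ℝ) :
    kFun α y w = -(w ^ α * (Real.log w * FH α (w ^ α) y + FL α (w ^ α) y)) := by
  unfold kFun FH FL Tq stableDensityDalpha
  have h := conv_fourier (int_log hα) hw y
  have e : ∀ z : ℝ, gauss (y - w * z) * (-(2 * Real.pi)⁻¹ * ∫ u : ℝ, Real.cos (z * u) * |u| ^ α * Real.log |u| * Real.exp (-(|u| ^ α))) =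
    (-(2 * Real.pi)⁻¹) * (gauss (y - w * z) * (∫ u : ℝ, Real.cos (z * u) * (|u| ^ α * Real.log |u| * Real.exp (-(|u| ^ α))))) := by
    intro z; simp only [mul_assoc]; ring
  simp only [e]
  rw [integral_const_mul, h]
  have e2 : ∀ v : ℝ, Real.cos (y * v) * (Real.exp (-(v ^ 2) / 2) * (|w * v| ^ α * Real.log |w * v| * Real.exp (-(|w * v| ^ α)))) =
    w ^ α * Real.log w * (Real.cos (y * v) * (Real.exp (-(v ^ 2) / 2) * qH α (w ^ α) |v|)) +
    w ^ α * (Real.cos (y * v) * (Real.exp (-(v ^ 2) / 2) * qL α (w ^ α) |v|)) := by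
    intro v
    unfold qH qL
    rw [mul_abs_rpow hw]
    rcases eq_or_ne v 0 with rfl | hv
    · simp [Real.zero_rpow hα.ne']
    · rw [abs_mul, abs_of_pos hw, Real.log_mul hw.ne' (abs_ne_zero.2 hv)]; ring
  have hε : 0 ≤ w ^ α := by positivity
  simp only [e2]
  rw [integral_add ((int_H hα hε y).const_mul _) ((int_L hα hε y).const_mul _), integral_const_mul, integral_const_mul]
  ring



lemma one_log_le {α y : ℝ} (hα : 0 < α) (hy : 1 ≤ y) : 1 + Real.log y ≤ (1 + 4 / α) * y ^ (α / 4) := by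
  have h1 := Real.log_le_rpow_div (by linarith : 0 ≤ y) (by linarith : 0 < α / 4)
  have h2 : 1 ≤ y ^ (α / 4) := Real.one_le_rpow hy (by linarith)
  have h3 : y ^ (α / 4) / (α / 4) = 4 / α * y ^ (α / 4) := by field_simp
  rw [h3] at h1
  linarith

lemma main_integrable {α a c M : ℝ} (hα : 0 < α) (hM : 1 ≤ M) :
    IntegrableOn (fun y : ℝ => y ^ (-(1 + α)) * (a - c * Real.log (y / M))) (Ioi M) := by
  have hM0 : 0 < M := by linarith
  have h0 := (integrableOn_Ioi_rpow_of_lt (a := -(1 + 3 * α / 4)) (by linarith) hM0).const_mul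
    ((|a| + |c|) * (1 + 4 / α))
  have hl := Real.measurable_log
  refine Integrable.mono' h0 (by fun_prop : Measurable _).aestronglyMeasurable ?_
  refine (ae_restrict_iff' measurableSet_Ioi).2 (Eventually.of_forall fun y hy => ?_)
  have hy0 : M < y := hy
  have hy1 : 0 < y := by linarith
  have hlog : |Real.log (y / M)| ≤ Real.log y := by
    rw [Real.log_div hy1.ne' hM0.ne', abs_of_nonneg (sub_nonneg.2 (Real.log_le_log hM0 hy0.le))]
    linarith [Real.log_nonneg hM]
  have hly : 0 ≤ Real.log y := Real.log_nonneg (by linarith)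
  rw [norm_mul, Real.norm_of_nonneg (by positivity), Real.norm_eq_abs]
  have h1 : |a - c * Real.log (y / M)| ≤ (|a| + |c|) * (1 + Real.log y) := by
    refine (abs_sub _ _).trans ?_
    rw [abs_mul]
    have : |c| * |Real.log (y / M)| ≤ |c| * Real.log y := by gcongr
    nlinarith [abs_nonneg a, abs_nonneg c, mul_nonneg (abs_nonneg a) hly]
  have h2 := one_log_le hα (by linarith : 1 ≤ y)
  have e : y ^ (-(1 + 3 * α / 4)) = y ^ (-(1 + α)) * y ^ (α / 4) := by
    rw [← Real.rpow_add hy1]; congr 1; ring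
  rw [e]
  calc _ ≤ y ^ (-(1 + α)) * ((|a| + |c|) * ((1 + 4 / α) * y ^ (α / 4))) := by
        gcongr
        exact h1.trans (by gcongr)
    _ = _ := by ring

lemma main_integral {α a c M : ℝ} (hα : 0 < α) (hM : 1 ≤ M) :
    ∫ y in Ioi M, y ^ (-(1 + α)) * (a - c * Real.log (y / M)) = M ^ (-α) * (a / α - c / α ^ 2) := by
  have hM0 : 0 < M := by linarith
  have h := integral_Ioi_of_hasDerivAt_of_tendsto'
    (f := fun y : ℝ => y ^ (-α) * (-(a - c * Real.log (y / M)) / α + c / α ^ 2))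
    (f' := fun y : ℝ => y ^ (-(1 + α)) * (a - c * Real.log (y / M))) (a := M) (m := 0) ?_
    (main_integrable hα hM) ?_
  · rw [h, div_self hM0.ne', Real.log_one]; ring
  · intro y hy
    have hy1 : 0 < y := lt_of_lt_of_le hM0 hy
    have d1 := Real.hasDerivAt_rpow_const (x := y) (p := -α) (Or.inl hy1.ne')
    have d2 : HasDerivAt (fun y : ℝ => Real.log (y / M)) (y⁻¹) y := by
      have := ((hasDerivAt_id y).div_const M).log (by positivity)
      refine this.congr_deriv ?_
      simp; field_simp
    have d3 := d1.mul (((((d2.const_mul c).const_sub a).neg).div_const α).add_const (c / α ^ 2))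
    refine d3.congr_deriv ?_
    have e1 : y ^ (-α - 1) = y ^ (-(1 + α)) := by congr 1; ring
    have e2 : y ^ (-α) = y * y ^ (-(1 + α)) := by
      rw [← Real.rpow_one_add' hy1.le (by linarith)]; congr 1; ring
    simp only [Pi.neg_apply]
    rw [e1, e2]
    field_simp
    ring
  · have t1 : Tendsto (fun y : ℝ => y ^ (-α)) atTop (𝓝 0) := tendsto_rpow_neg_atTop hα
    have t2 : Tendsto (fun y : ℝ => Real.log y * y ^ (-α)) atTop (𝓝 0) := by
      have := (isLittleO_log_rpow_atTop hα).tendsto_div_nhds_zero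
      refine this.congr' ?_
      filter_upwards [eventually_ge_atTop 0] with y hy
      rw [Real.rpow_neg hy, div_eq_mul_inv]
    have t3 := (t1.mul_const (-(a + c * Real.log M) / α + c / α ^ 2)).add (t2.mul_const (c / α))
    simp only [zero_mul, add_zero] at t3
    refine t3.congr' ?_
    filter_upwards [eventually_gt_atTop 0] with y hy
    rw [Real.log_div hy.ne' hM0.ne']
    ring

lemma reg3_alg {c p ε e1 e3 A e4 η K Λ : ℝ} (hc : 0 < c) (hp : 0 < p) (hε : 0 < ε) (h1 : |e1| ≤ η)
    (h3 : |e3| ≤ η) (hη : η ≤ c / 2) (hA : |A| ≤ K * Λ) (h4 : |e4| ≤ K * η * Λ) :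
    |ε ^ 2 * (-p * (c + e1)) * (-p * (A + e4)) / (ε * p * (c + e3)) - ε * p * A| ≤
      ε * p * (K * η * Λ * (4 / c + 3)) := by
  have hη0 : 0 ≤ η := (abs_nonneg _).trans h1
  have hKΛ : 0 ≤ K * Λ := (abs_nonneg _).trans hA
  have hpos : c / 2 ≤ c + e3 := by have := neg_le_of_abs_le h3; linarith
  have hpos' : 0 < c + e3 := by linarith
  have e : ε ^ 2 * (-p * (c + e1)) * (-p * (A + e4)) / (ε * p * (c + e3)) - ε * p * A =
      ε * p * (((e1 - e3) * A + (c + e1) * e4) / (c + e3)) := by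
    field_simp; ring
  rw [e, abs_mul, abs_of_pos (mul_pos hε hp), abs_div, abs_of_pos hpos']
  apply mul_le_mul_of_nonneg_left _ (mul_pos hε hp).le
  rw [div_le_iff₀ hpos']
  have hc1 : |c + e1| ≤ 3 * c / 2 := by
    refine (abs_add_le _ _).trans ?_
    rw [abs_of_pos hc]; linarith
  have b1 : |(e1 - e3) * A + (c + e1) * e4| ≤ 2 * η * (K * Λ) + (3 * c / 2) * (K * η * Λ) := by
    refine (abs_add_le _ _).trans ?_
    rw [abs_mul, abs_mul]
    gcongr
    refine (abs_sub _ _).trans ?_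
    linarith
  have b2 : K * η * Λ * (4 / c + 3) * (c / 2) = 2 * η * (K * Λ) + (3 * c / 2) * (K * η * Λ) := by
    field_simp; ring
  have b3 : 0 ≤ K * η * Λ * (4 / c + 3) := by
    have : K * η * Λ = (K * Λ) * η := by ring
    rw [this]; positivity
  have := mul_le_mul_of_nonneg_left hpos b3
  linarith

lemma reg2_alg {c p ε e1 A e4 η B f : ℝ} (hc : 0 < c) (hp : 0 < p) (hε : 0 < ε) (h1 : |e1| ≤ η)
    (hη : η ≤ c / 2) (hA : |A| ≤ B) (h4 : |e4| ≤ B) (hf : ε * p * (c / 2) ≤ f) :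
    |ε ^ 2 * (-p * (c + e1)) * (-p * (A + e4)) / f| ≤ ε * p * (6 * B) := by
  have hf0 : 0 < f := lt_of_lt_of_le (by positivity) hf
  have hB : 0 ≤ B := (abs_nonneg _).trans hA
  rw [abs_div, abs_of_pos hf0, div_le_iff₀ hf0]
  have hc1 : |c + e1| ≤ 3 * c / 2 := by
    refine (abs_add_le _ _).trans ?_
    rw [abs_of_pos hc]; linarith
  have hA4 : |A + e4| ≤ 2 * B := (abs_add_le _ _).trans (by linarith)
  have : |ε ^ 2 * (-p * (c + e1)) * (-p * (A + e4))| = ε ^ 2 * p ^ 2 * (|c + e1| * |A + e4|) := by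
    rw [abs_mul, abs_mul, abs_mul, abs_mul, abs_neg, abs_of_pos hp, abs_of_pos (by positivity : 0 < ε ^ 2)]; ring
  rw [this]
  calc _ ≤ ε ^ 2 * p ^ 2 * ((3 * c / 2) * (2 * B)) := by gcongr
    _ = ε * p * (6 * B) * (ε * p * (c / 2)) := by ring
    _ ≤ _ := by gcongr

lemma norm_form {x p c E : ℝ} (hp : 0 < p) (h : |x + c * p| ≤ E * p) : ∃ e, x = -p * (c + e) ∧ |e| ≤ E := by
  refine ⟨-(x + c * p) / p, ?_, ?_⟩
  · field_simp; ring
  · rw [abs_div, abs_neg, abs_of_pos hp, div_le_iff₀ hp]; exact h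



def Facts (α c d C ε : ℝ) (H L f : ℝ → ℝ) : Prop :=
  (∀ y, 0 < y → |H y| ≤ C ∧ |L y| ≤ C ∧ |f y - gauss y| ≤ C * ε) ∧
  (∀ y, 1 ≤ y →
      |H y + c * y ^ (-(1 + α))| ≤ C * y ^ (-(1 + α)) * (1 / y ^ 2 + ε) ∧
      |L y + (d - c * Real.log y) * y ^ (-(1 + α))| ≤
        C * (1 + Real.log y) * y ^ (-(1 + α)) * (1 / y ^ 2 + ε) ∧
      |f y - gauss y - ε * (c * y ^ (-(1 + α)))| ≤
        C * ε * y ^ (-(1 + α)) * (1 / y ^ 2 + ε))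

set_option maxHeartbeats 800000 in
lemma reg1 {C κ : ℝ} (hC : 0 < C) (hκ : 0 < κ) : ∃ K : ℝ, 0 < K ∧ ∃ M1 : ℝ,
    ∀ (α c d b0 M : ℝ) (H L f : ℝ → ℝ), 1 ≤ M → M1 ≤ M →
    Facts α c d C (κ * Real.exp (-(M ^ 2) / 2)) H L f → ∀ y, 0 < y → y ≤ M - 1 →
    |(κ * Real.exp (-(M ^ 2) / 2)) ^ 2 * H y * ((b0 + Real.log M) * H y + L y) / f y| ≤
      (κ * Real.exp (-(M ^ 2) / 2)) * (K * (1 + |b0| + M) * Real.exp (-M)) := by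
  set s := Real.sqrt (2 * Real.pi) with hs
  have hs0 : 0 < s := by have := Real.pi_pos; positivity
  refine ⟨2 * κ * s * Real.exp (1 / 2) * C ^ 2, by positivity, 2 * C * κ * s + 1, ?_⟩
  intro α c d b0 M H L f hM hM1 hF y hy hyM
  set ε := κ * Real.exp (-(M ^ 2) / 2) with hεd
  have hε : 0 < ε := by positivity
  obtain ⟨hH, hL, hf⟩ := hF.1 y hy
  have hg : s⁻¹ * (ε / κ * Real.exp (M - 1 / 2)) ≤ gauss y := by
    have e : ε / κ * Real.exp (M - 1 / 2) = Real.exp (-((M - 1) ^ 2) / 2) := by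
      rw [hεd, mul_div_cancel_left₀ _ hκ.ne', ← Real.exp_add]; congr 1; ring
    rw [e]
    unfold gauss
    gcongr
  have hexp : 2 * C * κ * s ≤ Real.exp (M - 1 / 2) := by
    have := Real.add_one_le_exp (M - 1 / 2); linarith
  have hCe : C * ε ≤ s⁻¹ * (ε / κ * Real.exp (M - 1 / 2)) / 2 := by
    have h2 : s⁻¹ * (ε / κ * (2 * C * κ * s)) / 2 ≤ s⁻¹ * (ε / κ * Real.exp (M - 1 / 2)) / 2 := by gcongr
    refine le_trans (le_of_eq ?_) h2
    field_simp
  have hfl : s⁻¹ * (ε / κ * Real.exp (M - 1 / 2)) / 2 ≤ f y := by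
    have := neg_le_of_abs_le hf
    linarith
  have hf0 : 0 < f y := lt_of_lt_of_le (by positivity) hfl
  have hb : |(b0 + Real.log M) * H y + L y| ≤ C * (1 + |b0| + M) := by
    refine (abs_add_le _ _).trans ?_
    rw [abs_mul]
    have hlM : |b0 + Real.log M| ≤ |b0| + M := by
      refine (abs_add_le _ _).trans ?_
      rw [abs_of_nonneg (Real.log_nonneg hM)]
      linarith [Real.log_le_self (by linarith : 0 ≤ M)]
    have : |b0 + Real.log M| * |H y| ≤ (|b0| + M) * C := by gcongr
    linarith
  rw [abs_div, abs_of_pos hf0, div_le_iff₀ hf0, abs_mul, abs_mul, abs_of_pos (by positivity : 0 < ε ^ 2)]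
  calc _ ≤ ε ^ 2 * C * (C * (1 + |b0| + M)) := by gcongr
    _ = ε * ((2 * κ * s * Real.exp (1 / 2) * C ^ 2) * (1 + |b0| + M) * Real.exp (-M)) *
        (s⁻¹ * (ε / κ * Real.exp (M - 1 / 2)) / 2) := by
      have e : Real.exp (1 / 2) * Real.exp (-M) * Real.exp (M - 1 / 2) = 1 := by
        rw [← Real.exp_add, ← Real.exp_add, show 1 / 2 + -M + (M - 1 / 2) = 0 by ring, Real.exp_zero]
      have : s * s⁻¹ = 1 := mul_inv_cancel₀ hs0.ne'
      have h3 : κ * (ε / κ) = ε := by field_simp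
      calc _ = ε * ε * C ^ 2 * (1 + |b0| + M) * 1 * 1 := by ring
        _ = ε * (κ * (ε / κ)) * C ^ 2 * (1 + |b0| + M) * (s * s⁻¹) *
          (Real.exp (1 / 2) * Real.exp (-M) * Real.exp (M - 1 / 2)) := by rw [e, this, h3]
        _ = _ := by ring
    _ ≤ _ := by
      apply mul_le_mul_of_nonneg_left hfl
      have : 0 ≤ 1 + |b0| + M := by have := abs_nonneg b0; linarith
      positivity

/-- normal forms for `y ≥ M - 1` -/
lemma nform {α c d C κ : ℝ} (hα : 0 < α) (hα2 : α < 2) (hC : 0 < C) (hκ : 0 < κ) {b0 M y : ℝ} {H L f : ℝ → ℝ}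
    (hM : 2 ≤ M) (hF : Facts α c d C (κ * Real.exp (-(M ^ 2) / 2)) H L f) (hy : M - 1 < y) :
    ∃ e1 e4 e5 : ℝ, H y = -(y ^ (-(1 + α))) * (c + e1) ∧
      (b0 + Real.log M) * H y + L y = -(y ^ (-(1 + α))) * ((c * b0 + d - c * Real.log (y / M)) + e4) ∧
      f y = gauss y + (κ * Real.exp (-(M ^ 2) / 2)) * y ^ (-(1 + α)) * (c + e5) ∧
      |e1| ≤ C * (4 + κ) / M ∧ |e5| ≤ C * (4 + κ) / M ∧
      |e4| ≤ (|b0| + Real.log M + 1 + Real.log y) * (C * (4 + κ) / M) := by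
  set ε := κ * Real.exp (-(M ^ 2) / 2) with hεd
  have hM0 : 0 < M := by linarith
  have hε : 0 < ε := by positivity
  have hy1 : 1 ≤ y := by linarith
  have hy0 : 0 < y := by linarith
  have hyM : M / 2 ≤ y := by linarith
  obtain ⟨h1, h2, h3⟩ := hF.2 y hy1
  have hp : 0 < y ^ (-(1 + α)) := Real.rpow_pos_of_pos hy0 _
  have hlM : 0 ≤ Real.log M := Real.log_nonneg (by linarith)
  have hly : 0 ≤ Real.log y := Real.log_nonneg hy1
  have hr : 1 / y ^ 2 + ε ≤ (4 + κ) / M := by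
    have a1 : 1 / y ^ 2 ≤ 4 / M := by
      rw [div_le_div_iff₀ (by positivity) hM0]
      nlinarith
    have a2 : ε ≤ κ / M := by
      rw [hεd, div_eq_mul_inv κ M]
      gcongr
      rw [show -(M ^ 2) / 2 = -(M ^ 2 / 2) by ring, Real.exp_neg]
      have := Real.add_one_le_exp (M ^ 2 / 2)
      apply inv_anti₀ hM0
      nlinarith
    rw [add_div]; linarith
  obtain ⟨e1, q1, q1'⟩ := norm_form (x := H y) (c := c) (E := C * (4 + κ) / M) hp (h1.trans (by
    calc C * y ^ (-(1 + α)) * (1 / y ^ 2 + ε) ≤ C * y ^ (-(1 + α)) * ((4 + κ) / M) := by gcongr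
      _ = _ := by ring))
  obtain ⟨e2, q2, q2'⟩ := norm_form (x := L y) (c := d - c * Real.log y) (E := (1 + Real.log y) * (C * (4 + κ) / M)) hp (h2.trans (by
    calc C * (1 + Real.log y) * y ^ (-(1 + α)) * (1 / y ^ 2 + ε) ≤ C * (1 + Real.log y) * y ^ (-(1 + α)) * ((4 + κ) / M) := by gcongr
      _ = _ := by ring))
  obtain ⟨e3, q3, q3'⟩ := norm_form (x := -(f y - gauss y)) (c := c) (E := C * (4 + κ) / M) (mul_pos hε hp) (by
    rw [show -(f y - gauss y) + c * (ε * y ^ (-(1 + α))) = -(f y - gauss y - ε * (c * y ^ (-(1 + α)))) by ring, abs_neg]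
    refine h3.trans ?_
    calc C * ε * y ^ (-(1 + α)) * (1 / y ^ 2 + ε) ≤ C * ε * y ^ (-(1 + α)) * ((4 + κ) / M) := by gcongr
      _ = _ := by ring)
  refine ⟨e1, (b0 + Real.log M) * e1 + e2, e3, q1, ?_, by linarith, q1', q3', ?_⟩
  · rw [q1, q2, Real.log_div hy0.ne' hM0.ne']; ring
  · refine (abs_add_le _ _).trans ?_
    rw [abs_mul]
    have : |b0 + Real.log M| ≤ |b0| + Real.log M := by
      refine (abs_add_le _ _).trans ?_
      rw [abs_of_nonneg hlM]
    calc _ ≤ (|b0| + Real.log M) * (C * (4 + κ) / M) + (1 + Real.log y) * (C * (4 + κ) / M) := by gcongr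
      _ = _ := by ring

set_option maxHeartbeats 800000 in
lemma reg2 {α c d C κ b0 : ℝ} (hα : 0 < α) (hα2 : α < 2) (hc : 0 < c) (hC : 0 < C) (hκ : 0 < κ) :
    ∃ K : ℝ, 0 < K ∧ ∃ M1 : ℝ,
    ∀ (M : ℝ) (H L f : ℝ → ℝ), 2 ≤ M → M1 ≤ M →
    Facts α c d C (κ * Real.exp (-(M ^ 2) / 2)) H L f → ∀ y, M - 1 < y → y ≤ M + 1 →
    |(κ * Real.exp (-(M ^ 2) / 2)) ^ 2 * H y * ((b0 + Real.log M) * H y + L y) / f y| +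
      |(κ * Real.exp (-(M ^ 2) / 2)) * (y ^ (-(1 + α)) * (c * b0 + d - c * Real.log (y / M)))| ≤
      (κ * Real.exp (-(M ^ 2) / 2)) * (K * (M ^ (-(1 + α)) * (1 + Real.log M))) := by
  set B := c * |b0| + |d| + c + (|b0| + 1) * (c / 2) with hB
  have hB0 : 0 < B := by positivity
  refine ⟨8 * (7 * (2 * B)), by positivity, 2 * (C * (4 + κ)) / c, ?_⟩
  intro M H L f hM hM1 hF y hy1 hy2
  obtain ⟨e1, e4, e5, q1, q2, q3, h1, h5, h4⟩ := nform (b0 := b0) hα hα2 hC hκ hM hF hy1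
  set ε := κ * Real.exp (-(M ^ 2) / 2) with hεd
  have hM0 : 0 < M := by linarith
  have hε : 0 < ε := by positivity
  have hy0 : 0 < y := by linarith
  have hp : 0 < y ^ (-(1 + α)) := Real.rpow_pos_of_pos hy0 _
  have hlM : 0 ≤ Real.log M := Real.log_nonneg (by linarith)
  have hly : 0 ≤ Real.log y := Real.log_nonneg (by linarith)
  have hly2 : Real.log y ≤ 1 + Real.log M := by
    have : Real.log y ≤ Real.log (2 * M) := Real.log_le_log hy0 (by linarith)
    rw [Real.log_mul (by norm_num) hM0.ne'] at this
    linarith [Real.log_two_lt_d9]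
  have hη : C * (4 + κ) / M ≤ c / 2 := by
    rw [div_le_iff₀ hc] at hM1
    rw [div_le_iff₀ hM0]
    linarith
  have hg : 0 ≤ gauss y := by unfold gauss; positivity
  set Λ := 2 * (1 + Real.log M) with hΛ
  have hA : |c * b0 + d - c * Real.log (y / M)| ≤ B * Λ := by
    rw [Real.log_div hy0.ne' hM0.ne']
    have t1 : |c * b0 + d - c * (Real.log y - Real.log M)| ≤ c * |b0| + |d| + c * (Real.log y + Real.log M) := by
      refine (abs_sub _ _).trans ?_
      have := abs_add_le (c * b0) d
      rw [abs_mul, abs_of_pos hc] at this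
      rw [abs_mul, abs_of_pos hc]
      have h6 : |Real.log y - Real.log M| ≤ Real.log y + Real.log M := by
        refine (abs_sub _ _).trans ?_
        rw [abs_of_nonneg hly, abs_of_nonneg hlM]
      have := mul_le_mul_of_nonneg_left h6 hc.le
      linarith
    have t2 : c * |b0| + |d| + c * (Real.log y + Real.log M) ≤ (c * |b0| + |d| + c) * Λ := by
      have z1 : 0 ≤ c * |b0| + |d| := by positivity
      have z2 : 1 ≤ Λ := by linarith
      have z3 : Real.log y + Real.log M ≤ Λ := by linarith
      nlinarith
    have t3 : 0 ≤ (|b0| + 1) * (c / 2) * Λ := by positivity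
    rw [hB, add_mul]; linarith
  have h4' : |e4| ≤ B * Λ := by
    refine h4.trans ?_
    have t1 : |b0| + Real.log M + 1 + Real.log y ≤ (|b0| + 1) * Λ := by
      have := abs_nonneg b0
      have z2 : 1 ≤ Λ := by linarith
      nlinarith
    have : 0 ≤ (|b0| + 1) * Λ := by positivity
    calc _ ≤ ((|b0| + 1) * Λ) * (c / 2) := by gcongr
      _ ≤ B * Λ := by
        have t3 : 0 ≤ (c * |b0| + |d| + c) * Λ := by positivity
        rw [hB, add_mul]; linarith
  have hf : ε * y ^ (-(1 + α)) * (c / 2) ≤ f y := by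
    have : c / 2 ≤ c + e5 := by have := neg_le_of_abs_le h5; linarith
    have := mul_le_mul_of_nonneg_left this (mul_pos hε hp).le
    linarith
  have hfin := reg2_alg hc hp hε h1 hη hA h4' hf
  rw [← q1, ← q2] at hfin
  have hp2 : y ^ (-(1 + α)) ≤ 8 * M ^ (-(1 + α)) := by
    have a1 : y ^ (-(1 + α)) ≤ (M / 2) ^ (-(1 + α)) :=
      Real.rpow_le_rpow_of_nonpos (by linarith) (by linarith) (by linarith)
    have a2 : (M / 2) ^ (-(1 + α)) = M ^ (-(1 + α)) * 2 ^ (1 + α) := by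
      rw [Real.div_rpow hM0.le (by norm_num), Real.rpow_neg (by norm_num : (0:ℝ) ≤ 2) (1 + α)]
      field_simp
    have a3 : (2:ℝ) ^ (1 + α) ≤ 2 ^ (3 : ℝ) := Real.rpow_le_rpow_of_exponent_le (by norm_num) (by linarith)
    have a4 : (2:ℝ) ^ (3 : ℝ) = 8 := by norm_num
    rw [a4] at a3
    rw [a2] at a1
    have h7 : 0 < M ^ (-(1 + α)) := Real.rpow_pos_of_pos hM0 _
    calc _ ≤ _ := a1
      _ ≤ M ^ (-(1 + α)) * 8 := mul_le_mul_of_nonneg_left a3 h7.le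
      _ = _ := mul_comm _ _
  have hm : |ε * (y ^ (-(1 + α)) * (c * b0 + d - c * Real.log (y / M)))| ≤ ε * y ^ (-(1 + α)) * (B * Λ) := by
    rw [abs_mul ε, abs_mul (y ^ (-(1 + α))), abs_of_pos hε, abs_of_pos hp, mul_assoc ε]
    gcongr
  calc _ ≤ ε * y ^ (-(1 + α)) * (6 * (B * Λ)) + ε * y ^ (-(1 + α)) * (B * Λ) := add_le_add hfin hm
    _ = ε * y ^ (-(1 + α)) * (7 * (B * Λ)) := by ring
    _ ≤ ε * (8 * M ^ (-(1 + α))) * (7 * (B * Λ)) := by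
      have : 0 ≤ Λ := by linarith
      gcongr
    _ = _ := by rw [hΛ]; ring

lemma gauss_small {α κ M y : ℝ} (hα : 0 < α) (hα2 : α < 2) (hκ : 0 < κ) (hM : 2 ≤ M) (hy : M + 1 < y) :
    gauss y ≤ (κ * Real.exp (-(M ^ 2) / 2)) * y ^ (-(1 + α)) * (384 / κ / M) := by
  have hM0 : 0 < M := by linarith
  have hy0 : 0 < y := by linarith
  have h1 : gauss y ≤ Real.exp (-(M ^ 2) / 2) * Real.exp (-(y / 2)) := by
    unfold gauss
    have a : (Real.sqrt (2 * Real.pi))⁻¹ ≤ 1 := by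
      apply inv_le_one_of_one_le₀
      apply Real.one_le_sqrt.2
      linarith [Real.pi_gt_three]
    have b : Real.exp (-(y ^ 2) / 2) ≤ Real.exp (-(M ^ 2) / 2) * Real.exp (-(y / 2)) := by
      rw [← Real.exp_add]
      apply Real.exp_le_exp.2
      nlinarith
    calc _ ≤ 1 * (Real.exp (-(M ^ 2) / 2) * Real.exp (-(y / 2))) := by gcongr
      _ = _ := one_mul _
  have h2 : Real.exp (-(y / 2)) ≤ y ^ (-(1 + α)) * (384 / M) := by
    have a1 := Real.pow_div_factorial_le_exp (y / 2) (by linarith) 4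
    have a2 : (Nat.factorial 4 : ℝ) = 24 := by norm_num [Nat.factorial]
    rw [a2] at a1
    have a3 : y ^ (1 + α) * y ≤ y ^ 4 := by
      rw [← Real.rpow_add_one hy0.ne', ← Real.rpow_natCast]
      apply Real.rpow_le_rpow_of_exponent_le (by linarith)
      push_cast; linarith
    have hq : 0 < y ^ (1 + α) := Real.rpow_pos_of_pos hy0 _
    rw [Real.exp_neg, Real.rpow_neg hy0.le, ← div_eq_inv_mul, inv_eq_one_div, div_div,
      div_le_div_iff₀ (Real.exp_pos _) (by positivity)]
    have a4 : M * y ^ (1 + α) ≤ y ^ (1 + α) * y := by nlinarith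
    have a5 : (y / 2) ^ 4 / 24 = y ^ 4 / 384 := by ring
    rw [a5] at a1
    linarith
  calc _ ≤ _ := h1
    _ ≤ Real.exp (-(M ^ 2) / 2) * (y ^ (-(1 + α)) * (384 / M)) := by gcongr
    _ = _ := by field_simp

set_option maxHeartbeats 800000 in
lemma reg3 {α c d C κ b0 : ℝ} (hα : 0 < α) (hα2 : α < 2) (hc : 0 < c) (hC : 0 < C) (hκ : 0 < κ) :
    ∃ K : ℝ, 0 < K ∧ ∃ M1 : ℝ,
    ∀ (M : ℝ) (H L f : ℝ → ℝ), 2 ≤ M → M1 ≤ M →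
    Facts α c d C (κ * Real.exp (-(M ^ 2) / 2)) H L f → ∀ y, M + 1 < y →
    |(κ * Real.exp (-(M ^ 2) / 2)) ^ 2 * H y * ((b0 + Real.log M) * H y + L y) / f y -
      (κ * Real.exp (-(M ^ 2) / 2)) * (y ^ (-(1 + α)) * (c * b0 + d - c * Real.log (y / M)))| ≤
      (κ * Real.exp (-(M ^ 2) / 2)) * (K / M * y ^ (-(1 + 3 * α / 4))) := by
  set B := c * |b0| + |d| + c + |b0| + 2 with hB
  have hB0 : 0 < B := by positivity
  set K0 := C * (4 + κ) + 384 / κ with hK0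
  have hK00 : 0 < K0 := by positivity
  refine ⟨B * K0 * (4 / c + 3) * (1 + 4 / α), by positivity, 2 * K0 / c, ?_⟩
  intro M H L f hM hM1 hF y hy1
  obtain ⟨e1, e4, e5, q1, q2, q3, h1, h5, h4⟩ := nform (b0 := b0) hα hα2 hC hκ hM hF (by linarith : M - 1 < y)
  have hgs := gauss_small hα hα2 hκ hM hy1
  set ε := κ * Real.exp (-(M ^ 2) / 2) with hεd
  have hM0 : 0 < M := by linarith
  have hε : 0 < ε := by positivity
  have hy0 : 0 < y := by linarith
  have hp : 0 < y ^ (-(1 + α)) := Real.rpow_pos_of_pos hy0 _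
  have hlM : 0 ≤ Real.log M := Real.log_nonneg (by linarith)
  have hly : 0 ≤ Real.log y := Real.log_nonneg (by linarith)
  have hly2 : Real.log M ≤ Real.log y := Real.log_le_log hM0 (by linarith)
  have hη : K0 / M ≤ c / 2 := by
    rw [div_le_iff₀ hc] at hM1
    rw [div_le_iff₀ hM0]
    linarith
  have hle : C * (4 + κ) / M ≤ K0 / M := by
    gcongr
    have : 0 < 384 / κ := by positivity
    linarith
  have hg : 0 ≤ gauss y := by unfold gauss; positivity
  obtain ⟨e3, hf3, h3⟩ : ∃ e3, f y = ε * y ^ (-(1 + α)) * (c + e3) ∧ |e3| ≤ K0 / M := by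
    refine ⟨e5 + gauss y / (ε * y ^ (-(1 + α))), ?_, ?_⟩
    · rw [q3]; field_simp; ring
    · refine (abs_add_le _ _).trans ?_
      rw [abs_of_nonneg (by positivity : 0 ≤ gauss y / (ε * y ^ (-(1 + α))))]
      have : gauss y / (ε * y ^ (-(1 + α))) ≤ 384 / κ / M := by
        rw [div_le_iff₀ (by positivity)]; linarith
      rw [hK0, add_div]; linarith
  set Λ := 1 + Real.log y with hΛ
  have hΛ1 : 1 ≤ Λ := by linarith
  have hA : |c * b0 + d - c * Real.log (y / M)| ≤ B * Λ := by
    rw [Real.log_div hy0.ne' hM0.ne']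
    have t1 : |c * b0 + d - c * (Real.log y - Real.log M)| ≤ c * |b0| + |d| + c * Real.log y := by
      refine (abs_sub _ _).trans ?_
      have := abs_add_le (c * b0) d
      rw [abs_mul, abs_of_pos hc] at this
      rw [abs_mul, abs_of_pos hc, abs_of_nonneg (sub_nonneg.2 hly2)]
      nlinarith
    have z1 : c * |b0| + |d| ≤ (c * |b0| + |d|) * Λ := le_mul_of_one_le_right (by positivity) hΛ1
    have z4 : 0 ≤ (|b0| + 2) * Λ := by positivity
    have z2 : B * Λ = (c * |b0| + |d|) * Λ + c * (1 + Real.log y) + (|b0| + 2) * Λ := by rw [hB]; ring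
    rw [z2]
    linarith
  have h4' : |e4| ≤ B * (K0 / M) * Λ := by
    have t1 : |b0| + Real.log M + 1 + Real.log y ≤ B * Λ := by
      have z0 : |b0| ≤ |b0| * Λ := le_mul_of_one_le_right (abs_nonneg b0) hΛ1
      have z1 : 0 ≤ (c * |b0| + |d| + c) * Λ := by positivity
      have z2 : B * Λ = (c * |b0| + |d| + c) * Λ + |b0| * Λ + 2 * Λ := by rw [hB]; ring
      rw [z2]
      linarith
    calc _ ≤ _ := h4
      _ ≤ (B * Λ) * (K0 / M) := by gcongr
      _ = _ := by ring
  have hfin := reg3_alg hc hp hε (h1.trans hle) h3 hη hA h4'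
  rw [← q1, ← q2, ← hf3, mul_assoc ε (y ^ (-(1 + α))) (_ - _)] at hfin
  refine hfin.trans ?_
  have h6 := one_log_le hα (by linarith : 1 ≤ y)
  have e : y ^ (-(1 + 3 * α / 4)) = y ^ (-(1 + α)) * y ^ (α / 4) := by
    rw [← Real.rpow_add hy0]; congr 1; ring
  rw [e]
  calc _ ≤ ε * y ^ (-(1 + α)) * (B * (K0 / M) * ((1 + 4 / α) * y ^ (α / 4)) * (4 / c + 3)) := by gcongr
    _ = _ := by ring



set_option maxHeartbeats 800000 in
/-- integral of the dominating function -/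
lemma dom_bound {α a1 a2 a3 M : ℝ} (hα : 0 < α) (hM : 2 ≤ M) :
    ∃ E : ℝ → ℝ, IntegrableOn E (Ioi 0) ∧
      (∀ y, 0 < y → y ≤ M - 1 → E y = a1) ∧ (∀ y, M - 1 < y → y ≤ M + 1 → E y = a2) ∧
      (∀ y, M + 1 < y → E y = a3 * y ^ (-(1 + 3 * α / 4))) ∧
      ∫ y in Ioi 0, E y = (M - 1) * a1 + 2 * a2 + a3 * ((M + 1) ^ (-(3 * α / 4)) / (3 * α / 4)) := by
  have i1 : IntegrableOn (fun _ : ℝ => a1) (Ioc 0 (M - 1)) := by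
    rw [integrableOn_const_iff]; right; simp
  have i2 : IntegrableOn (fun _ : ℝ => a2) (Ioc (M - 1) (M + 1)) := by
    rw [integrableOn_const_iff]; right; simp
  have i3 : IntegrableOn (fun y : ℝ => a3 * y ^ (-(1 + 3 * α / 4))) (Ioi (M + 1)) :=
    (integrableOn_Ioi_rpow_of_lt (by linarith) (by linarith)).const_mul _
  have j1 := (i1.integrable_indicator measurableSet_Ioc)
  have j2 := (i2.integrable_indicator measurableSet_Ioc)
  have j3 := (i3.integrable_indicator measurableSet_Ioi)
  refine ⟨fun y => (Ioc 0 (M - 1)).indicator (fun _ => a1) y + ((Ioc (M - 1) (M + 1)).indicator (fun _ => a2) y +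
    (Ioi (M + 1)).indicator (fun y => a3 * y ^ (-(1 + 3 * α / 4))) y), ?_, ?_, ?_, ?_, ?_⟩
  · exact (j1.add (j2.add j3)).integrableOn
  · intro y h1 h2
    simp only
    rw [indicator_of_mem (show y ∈ Ioc 0 (M - 1) from ⟨h1, h2⟩), indicator_of_notMem (fun h => by have := h.1; linarith),
      indicator_of_notMem (fun h => by have : M + 1 < y := h; linarith)]; ring
  · intro y h1 h2
    simp only
    rw [indicator_of_notMem (fun h => by have := h.2; linarith), indicator_of_mem (show y ∈ Ioc (M - 1) (M + 1) from ⟨h1, h2⟩),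
      indicator_of_notMem (fun h => by have : M + 1 < y := h; linarith)]; ring
  · intro y h1
    simp only
    rw [indicator_of_notMem (fun h => by have := h.2; linarith), indicator_of_notMem (fun h => by have := h.2; linarith),
      indicator_of_mem (show y ∈ Ioi (M + 1) from h1)]; ring
  · have j23 : Integrable fun y => (Ioc (M - 1) (M + 1)).indicator (fun _ => a2) y +
      (Ioi (M + 1)).indicator (fun y => a3 * y ^ (-(1 + 3 * α / 4))) y := j2.add j3
    simp only
    rw [integral_add j1.integrableOn j23.integrableOn, integral_add j2.integrableOn j3.integrableOn,
      setIntegral_indicator measurableSet_Ioc, setIntegral_indicator measurableSet_Ioc,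
      setIntegral_indicator measurableSet_Ioi]
    rw [inter_eq_self_of_subset_right (show Ioc 0 (M - 1) ⊆ Ioi 0 from fun x hx => hx.1),
      inter_eq_self_of_subset_right (show Ioc (M - 1) (M + 1) ⊆ Ioi 0 from fun x hx => by have := hx.1; show 0 < x; linarith),
      inter_eq_self_of_subset_right (Ioi_subset_Ioi (by linarith) : Ioi (M + 1) ⊆ Ioi 0),
      integral_const_mul, integral_Ioi_rpow_of_lt (by linarith) (by linarith)]
    simp only [setIntegral_const, Real.volume_real_Ioc, smul_eq_mul]
    rw [max_eq_left (by linarith), max_eq_left (by linarith)]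
    have e : -(1 + 3 * α / 4) + 1 = -(3 * α / 4) := by ring
    rw [e, sub_zero, show M + 1 - (M - 1) = 2 by ring, neg_div, div_neg, neg_neg]
    ring

lemma final_num {α K1 K2 K3 b M : ℝ} (hα : 0 < α) (hα2 : α < 2) (hK1 : 0 < K1) (hK2 : 0 < K2) (hK3 : 0 < K3)
    (hb : 0 ≤ b) (hM : 2 ≤ M) :
    (M - 1) * (K1 * (1 + b + M) * Real.exp (-M)) + 2 * (K2 * (M ^ (-(1 + α)) * (1 + Real.log M))) +
      K3 / M * ((M + 1) ^ (-(3 * α / 4)) / (3 * α / 4)) ≤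
    (120 * K1 * (2 + b) + 6 * K2 + K3 * (4 / (3 * α))) * M ^ (-(α + 1 / 2)) := by
  have hM0 : 0 < M := by linarith
  have hq : 0 < M ^ (-(α + 1 / 2)) := Real.rpow_pos_of_pos hM0 _
  have hx : M ^ 2 * Real.exp (-M) ≤ 120 * M ^ (-(α + 1 / 2)) := by
    have a1 := Real.pow_div_factorial_le_exp M hM0.le 5
    have a2 : (Nat.factorial 5 : ℝ) = 120 := by norm_num [Nat.factorial]
    rw [a2] at a1
    have a3 : M ^ (α + 1 / 2) ≤ M ^ 3 := by
      rw [← Real.rpow_natCast]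
      apply Real.rpow_le_rpow_of_exponent_le (by linarith)
      push_cast; linarith
    have hq' : 0 < M ^ (α + 1 / 2) := Real.rpow_pos_of_pos hM0 _
    rw [Real.exp_neg, Real.rpow_neg hM0.le, ← div_eq_mul_inv, ← div_eq_mul_inv, div_le_div_iff₀ (Real.exp_pos _) hq']
    have : M ^ 2 * M ^ (α + 1 / 2) ≤ M ^ 2 * M ^ 3 := by gcongr
    have e : M ^ 2 * M ^ 3 = M ^ 5 := by ring
    linarith
  have t1 : (M - 1) * (K1 * (1 + b + M) * Real.exp (-M)) ≤ 120 * K1 * (2 + b) * M ^ (-(α + 1 / 2)) := by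
    have : (M - 1) * (1 + b + M) ≤ (2 + b) * M ^ 2 := by nlinarith [mul_nonneg hb hM0.le]
    calc _ = K1 * Real.exp (-M) * ((M - 1) * (1 + b + M)) := by ring
      _ ≤ K1 * Real.exp (-M) * ((2 + b) * M ^ 2) := by gcongr
      _ = K1 * (2 + b) * (M ^ 2 * Real.exp (-M)) := by ring
      _ ≤ K1 * (2 + b) * (120 * M ^ (-(α + 1 / 2))) := by gcongr
      _ = _ := by ring
  have t2 : 2 * (K2 * (M ^ (-(1 + α)) * (1 + Real.log M))) ≤ 6 * K2 * M ^ (-(α + 1 / 2)) := by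
    have h1 := Real.log_le_rpow_div hM0.le (by norm_num : (0:ℝ) < 1 / 2)
    have h2 : 1 ≤ M ^ (1 / 2 : ℝ) := Real.one_le_rpow (by linarith) (by norm_num)
    have h3 : 1 + Real.log M ≤ 3 * M ^ (1 / 2 : ℝ) := by linarith
    have e : M ^ (-(α + 1 / 2)) = M ^ (-(1 + α)) * M ^ (1 / 2 : ℝ) := by
      rw [← Real.rpow_add hM0]; congr 1; ring
    rw [e]
    calc _ ≤ 2 * (K2 * (M ^ (-(1 + α)) * (3 * M ^ (1 / 2 : ℝ)))) := by gcongr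
      _ = _ := by ring
  have t3 : K3 / M * ((M + 1) ^ (-(3 * α / 4)) / (3 * α / 4)) ≤ K3 * (4 / (3 * α)) * M ^ (-(α + 1 / 2)) := by
    have h1 : (M + 1) ^ (-(3 * α / 4)) ≤ M ^ (-(3 * α / 4)) :=
      Real.rpow_le_rpow_of_nonpos hM0 (by linarith) (by linarith)
    have h2 : M ^ (-(3 * α / 4)) / M ≤ M ^ (-(α + 1 / 2)) := by
      rw [← Real.rpow_sub_one hM0.ne']
      apply Real.rpow_le_rpow_of_exponent_le (by linarith)
      linarith
    calc _ ≤ K3 / M * (M ^ (-(3 * α / 4)) / (3 * α / 4)) := by gcongr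
      _ = K3 * (4 / (3 * α)) * (M ^ (-(3 * α / 4)) / M) := by field_simp
      _ ≤ _ := by gcongr
  linarith

set_option maxHeartbeats 800000 in
lemma core {α c d C κ b0 : ℝ} (hα : 0 < α) (hα2 : α < 2) (hc : 0 < c) (hC : 0 < C) (hκ : 0 < κ) :
    ∃ K : ℝ, 0 < K ∧ ∃ M0 : ℝ, ∀ (M ε : ℝ) (H L f : ℝ → ℝ), M0 ≤ M → ε = κ * Real.exp (-(M ^ 2) / 2) →
    Measurable H → Measurable L → Measurable f → Facts α c d C ε H L f →
    |(∫ y in Ioi 0, ε ^ 2 * H y * ((b0 + Real.log M) * H y + L y) / f y) -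
      ε * (M ^ (-α) * ((c * b0 + d) / α - c / α ^ 2))| ≤ K * (ε * M ^ (-(α + 1 / 2))) := by
  obtain ⟨K1, hK1, M1, R1⟩ := reg1 hC hκ
  obtain ⟨K2, hK2, M2, R2⟩ := reg2 (d := d) (b0 := b0) hα hα2 hc hC hκ
  obtain ⟨K3, hK3, M3, R3⟩ := reg3 (d := d) (b0 := b0) hα hα2 hc hC hκ
  refine ⟨120 * K1 * (2 + |b0|) + 6 * K2 + K3 * (4 / (3 * α)), by positivity, max 2 (max M1 (max M2 M3)), ?_⟩
  intro M ε H L f hM hεd mH mL mf hF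
  have hM2 : 2 ≤ M := (le_max_left _ _).trans hM
  have hMM := (le_max_right _ _).trans hM
  have g1 : M1 ≤ M := (le_max_left _ _).trans hMM
  have g2 : M2 ≤ M := (le_max_left _ _).trans ((le_max_right _ _).trans hMM)
  have g3 : M3 ≤ M := (le_max_right _ _).trans ((le_max_right _ _).trans hMM)
  have hε : 0 < ε := by rw [hεd]; positivity
  have S1 := R1 α c d b0 M H L f (by linarith) g1 (hεd ▸ hF)
  have S2 := R2 M H L f hM2 g2 (hεd ▸ hF)
  have S3 := R3 M H L f hM2 g3 (hεd ▸ hF)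
  rw [← hεd] at S1 S2 S3
  obtain ⟨E, hEi, E1, E2, E3, hE⟩ := dom_bound (a1 := ε * (K1 * (1 + |b0| + M) * Real.exp (-M)))
    (a2 := ε * (K2 * (M ^ (-(1 + α)) * (1 + Real.log M)))) (a3 := ε * (K3 / M)) hα hM2
  set g : ℝ → ℝ := fun y => ε ^ 2 * H y * ((b0 + Real.log M) * H y + L y) / f y with hg
  set m : ℝ → ℝ := (Ioi M).indicator fun y => ε * (y ^ (-(1 + α)) * (c * b0 + d - c * Real.log (y / M))) with hm
  have mint : IntegrableOn m (Ioi 0) := by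
    refine Integrable.integrableOn (IntegrableOn.integrable_indicator ?_ measurableSet_Ioi)
    exact (main_integrable hα (by linarith)).const_mul ε
  have mval : ∫ y in Ioi 0, m y = ε * (M ^ (-α) * ((c * b0 + d) / α - c / α ^ 2)) := by
    rw [hm, setIntegral_indicator measurableSet_Ioi,
      inter_eq_self_of_subset_right (Ioi_subset_Ioi (by linarith) : Ioi M ⊆ Ioi 0), integral_const_mul,
      main_integral hα (by linarith)]
  have hdom : ∀ y, 0 < y → |g y - m y| ≤ E y := by
    intro y hy
    rcases le_or_gt y (M - 1) with h1 | h1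
    · have : m y = 0 := indicator_of_notMem (fun h => by have : M < y := h; linarith) _
      rw [this, sub_zero, E1 y hy h1]
      exact S1 y hy h1
    · rcases le_or_gt y (M + 1) with h2 | h2
      · rw [E2 y h1 h2]
        refine le_trans ?_ (S2 y h1 h2)
        refine (abs_sub _ _).trans ?_
        refine add_le_add le_rfl ?_
        rw [hm]
        by_cases h : y ∈ Ioi M
        · rw [indicator_of_mem h]
        · rw [indicator_of_notMem h, abs_zero]; exact abs_nonneg _
      · have : m y = ε * (y ^ (-(1 + α)) * (c * b0 + d - c * Real.log (y / M))) :=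
          indicator_of_mem (show y ∈ Ioi M by show M < y; linarith) _
        rw [this, E3 y h2, mul_assoc]
        exact S3 y h2
  have gmeas : Measurable g := by rw [hg]; fun_prop
  have dint : IntegrableOn (fun y => g y - m y) (Ioi 0) := by
    refine Integrable.mono' hEi (gmeas.aestronglyMeasurable.sub mint.aestronglyMeasurable) ?_
    exact (ae_restrict_iff' measurableSet_Ioi).2 (Eventually.of_forall fun y hy => hdom y hy)
  have gint : IntegrableOn g (Ioi 0) := by
    have := dint.add mint
    refine this.congr (Eventually.of_forall fun y => ?_)
    simp
  rw [← mval, ← integral_sub gint mint]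
  have hb : |∫ y in Ioi 0, (g y - m y)| ≤ ∫ y in Ioi 0, E y := by
    rw [← Real.norm_eq_abs]
    refine norm_integral_le_of_norm_le hEi ?_
    exact (ae_restrict_iff' measurableSet_Ioi).2 (Eventually.of_forall fun y hy => hdom y hy)
  refine hb.trans ?_
  rw [hE]
  have hn := mul_le_mul_of_nonneg_left (final_num hα hα2 hK1 hK2 hK3 (abs_nonneg b0) hM2) hε.le
  linarith



lemma wn_facts {n : ℕ} {σ δ α ℓ M : ℝ} (hσ : 0 < σ) (hδ : 0 < δ) (hα : 0 < α) (hn : 0 < (n : ℝ))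
    (hℓ : ℓ = Real.log n) (hM : M ^ 2 = (2 - α) * ℓ) :
    0 < wn n σ δ α ∧ wn n σ δ α ^ α = (δ / σ) ^ α * Real.exp (-(M ^ 2) / 2) ∧
    Real.log (wn n σ δ α) = (1 / 2 - 1 / α) * ℓ + Real.log (δ / σ) := by
  have hw : wn n σ δ α = (n : ℝ) ^ ((1 : ℝ) / 2 - 1 / α) * (δ / σ) := by unfold wn; ring
  have hp : 0 < (n : ℝ) ^ ((1 : ℝ) / 2 - 1 / α) := Real.rpow_pos_of_pos hn _
  have hd : 0 < δ / σ := by positivity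
  rw [hw]
  refine ⟨by positivity, ?_, ?_⟩
  · rw [Real.mul_rpow hp.le hd.le, mul_comm, ← Real.rpow_mul hn.le, Real.rpow_def_of_pos hn, hM, hℓ]
    congr 2
    field_simp
    ring
  · rw [Real.log_mul hp.ne' hd.ne', Real.log_rpow hn, hℓ]

lemma integrand_eq {n : ℕ} {σ δ α ℓ M : ℝ} (hσ : 0 < σ) (hδ : 0 < δ) (hα : 0 < α) (hα2 : α < 2) (hn : 0 < (n : ℝ))
    (hℓ : ℓ = Real.log n) (hℓ0 : 0 < ℓ) (hM0 : 0 < M) (hM : M ^ 2 = (2 - α) * ℓ) (y : ℝ) :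
    hFun α y (wn n σ δ α) * lFun n α y (wn n σ δ α) / fFun α y (wn n σ δ α) =
    -α * ((wn n σ δ α ^ α) ^ 2 * FH α (wn n σ δ α ^ α) y *
      ((Real.log (δ / σ) - Real.log (2 - α) / 2 + Real.log M) * FH α (wn n σ δ α ^ α) y +
        FL α (wn n σ δ α ^ α) y) / Ff α (wn n σ δ α ^ α) y) := by
  obtain ⟨hw, -, hlw⟩ := wn_facts hσ hδ hα hn hℓ hM
  have hlM : Real.log M = (Real.log (2 - α) + Real.log ℓ) / 2 := by
    have := congrArg Real.log hM
    rw [Real.log_pow, Real.log_mul (by linarith) hℓ0.ne'] at this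
    push_cast at this
    linarith
  unfold lFun
  rw [hFun_eq hα hw, kFun_eq hα hw, fFun_eq hα hw, hlw, hlM, ← hℓ, ← mul_div_assoc]
  congr 1
  field_simp
  ring

set_option maxHeartbeats 800000 in
/-- asymptotics of `∫ h_α l_α / f_α`. -/
theorem statement12 (σ δ α : ℝ) (hσ : 0 < σ) (hδ : 0 < δ) (hα : α ∈ Set.Ioo (0 : ℝ) 2) :
    ∃ C > (0 : ℝ), ∃ N : ℕ, ∀ n ≥ N,
      |(∫ y : ℝ, hFun α y (wn n σ δ α) * lFun n α y (wn n σ δ α) / fFun α y (wn n σ δ α))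
          + α * kappa0 σ δ α * kappa1 σ δ α /
            ((n : ℝ) ^ (1 - α / 2) * Real.log n ^ (α / 2))| ≤
        C * (1 / ((n : ℝ) ^ (1 - α / 2) * Real.log n ^ (α / 2))) *
          (Real.log (Real.log n) ^ 2 / Real.log n ^ (min (1 / 4 : ℝ) α)) := by
  obtain ⟨h0, h2⟩ := hα
  have hd : 0 < δ / σ := by positivity
  have h2' : 0 < 2 - α := by linarith
  have hc : 0 < cAlpha α := cAlpha_pos h0 h2
  obtain ⟨C, hC, hT⟩ := tail_facts h0 h2
  set κ := (δ / σ) ^ α with hκd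
  have hκ : 0 < κ := by positivity
  set b0 := Real.log (δ / σ) - Real.log (2 - α) / 2 with hb0
  obtain ⟨K, hK, M0, hcore⟩ := core (d := deriv cAlpha α) (b0 := b0) h0 h2 hc hC hκ
  refine ⟨2 * α * K * κ * (2 - α) ^ (-(α / 2)) * (2 - α) ^ (-(1 / 4 : ℝ)), by positivity, ?_⟩
  have hlog : Tendsto (fun n : ℕ => Real.log (n : ℝ)) atTop atTop :=
    Real.tendsto_log_atTop.comp tendsto_natCast_atTop_atTop
  have hMt : Tendsto (fun n : ℕ => Real.sqrt ((2 - α) * Real.log (n : ℝ))) atTop atTop :=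
    Real.tendsto_sqrt_atTop.comp (hlog.const_mul_atTop h2')
  have hll : Tendsto (fun n : ℕ => Real.log (Real.log (n : ℝ))) atTop atTop :=
    Real.tendsto_log_atTop.comp hlog
  obtain ⟨N, hN⟩ := eventually_atTop.1 (((hlog.eventually_ge_atTop 1).and (hMt.eventually_ge_atTop M0)).and
    ((hll.eventually_ge_atTop 1).and (eventually_gt_atTop 0)))
  refine ⟨N, fun n hn => ?_⟩
  obtain ⟨⟨hℓ1, hMM0⟩, hll1, hn0⟩ := hN n hn
  have hnp : 0 < (n : ℝ) := by exact_mod_cast hn0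
  set ℓ := Real.log (n : ℝ) with hℓ
  set M := Real.sqrt ((2 - α) * ℓ) with hMd
  have hℓ0 : 0 < ℓ := by linarith
  have hMp : 0 < M := by positivity
  have hM2 : M ^ 2 = (2 - α) * ℓ := Real.sq_sqrt (by positivity)
  obtain ⟨hw, hwε, hlw⟩ := wn_facts hσ hδ h0 hnp hℓ hM2
  simp only [integrand_eq hσ hδ h0 h2 hnp hℓ hℓ0 hMp hM2]
  set ε := wn n σ δ α ^ α with hεd
  have hε : 0 ≤ ε := by rw [hwε]; positivity
  have hF : Facts α (cAlpha α) (deriv cAlpha α) C ε (FH α ε) (FL α ε) (Ff α ε) := hT ε hε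
  have hmain := hcore M ε (FH α ε) (FL α ε) (Ff α ε) hMM0 hwε (Tq_measurable (qH_meas α ε))
    (Tq_measurable (qL_meas α ε)) (Tq_measurable (qf_meas α ε)) hF
  rw [integral_const_mul]
  have hev : (∫ y : ℝ, ε ^ 2 * FH α ε y * ((b0 + Real.log M) * FH α ε y + FL α ε y) / Ff α ε y) =
      2 * ∫ y in Ioi 0, ε ^ 2 * FH α ε y * ((b0 + Real.log M) * FH α ε y + FL α ε y) / Ff α ε y := by
    rw [← integral_comp_abs (f := fun y => ε ^ 2 * FH α ε y * ((b0 + Real.log M) * FH α ε y + FL α ε y) / Ff α ε y)]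
    congr 1; ext y
    simp only [FH, FL, Ff, Tq_even]
  rw [hev]
  set I := ∫ y in Ioi 0, ε ^ 2 * FH α ε y * ((b0 + Real.log M) * FH α ε y + FL α ε y) / Ff α ε y with hI
  set D := (n : ℝ) ^ (1 - α / 2) * ℓ ^ (α / 2) with hD
  have hDp : 0 < D := by positivity
  have hMpow : ∀ r : ℝ, M ^ r = (2 - α) ^ (r / 2) * ℓ ^ (r / 2) := by
    intro r
    rw [hMd, Real.sqrt_eq_rpow, ← Real.rpow_mul (by positivity), Real.mul_rpow h2'.le hℓ0.le]
    congr 2 <;> ring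
  have hεn : ε = κ * (n : ℝ) ^ (-(1 - α / 2)) := by
    rw [hwε, Real.rpow_def_of_pos hnp, ← hℓ, hM2]; congr 2; ring
  have hεM : ε * M ^ (-α) = κ * (2 - α) ^ (-(α / 2)) / D := by
    rw [hεn, hMpow, hD, neg_div, Real.rpow_neg hnp.le, Real.rpow_neg hℓ0.le]
    field_simp
  have hk : α * kappa0 σ δ α * kappa1 σ δ α / D =
      2 * α * (ε * (M ^ (-α) * ((cAlpha α * b0 + deriv cAlpha α) / α - cAlpha α / α ^ 2))) := by
    rw [← mul_assoc ε, hεM]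
    unfold kappa0 kappa1
    rw [← hκd, hb0, Real.rpow_neg h2'.le]
    field_simp
    ring
  have hM' : ε * M ^ (-(α + 1 / 2)) ≤ κ * (2 - α) ^ (-(α / 2)) / D * ((2 - α) ^ (-(1 / 4 : ℝ)) *
      (Real.log ℓ ^ 2 / ℓ ^ (min (1 / 4 : ℝ) α))) := by
    have e : M ^ (-(α + 1 / 2)) = M ^ (-α) * M ^ (-(1 / 2) : ℝ) := by
      rw [← Real.rpow_add hMp]; congr 1; ring
    rw [e, ← mul_assoc, hεM, hMpow]
    have e2 : (-(1 / 2) / 2 : ℝ) = -(1 / 4) := by norm_num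
    rw [e2]
    have h5 : ℓ ^ (-(1 / 4) : ℝ) ≤ Real.log ℓ ^ 2 / ℓ ^ (min (1 / 4 : ℝ) α) := by
      have a1 : ℓ ^ (-(1 / 4) : ℝ) ≤ ℓ ^ (-(min (1 / 4 : ℝ) α)) :=
        Real.rpow_le_rpow_of_exponent_le hℓ1 (neg_le_neg (min_le_left _ _))
      have a0 : ℓ ^ (-(min (1 / 4 : ℝ) α)) = (ℓ ^ (min (1 / 4 : ℝ) α))⁻¹ := Real.rpow_neg hℓ0.le _
      rw [a0] at a1
      have a2 : 1 ≤ Real.log ℓ ^ 2 := one_le_pow₀ hll1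
      have a3 : 0 ≤ (ℓ ^ (min (1 / 4 : ℝ) α))⁻¹ := by positivity
      rw [div_eq_mul_inv]
      exact a1.trans (le_mul_of_one_le_left a3 a2)
    gcongr
  rw [hk]
  have e : -α * (2 * I) + 2 * α * (ε * (M ^ (-α) * ((cAlpha α * b0 + deriv cAlpha α) / α - cAlpha α / α ^ 2))) =
      -(2 * α) * (I - ε * (M ^ (-α) * ((cAlpha α * b0 + deriv cAlpha α) / α - cAlpha α / α ^ 2))) := by ring
  rw [e, abs_mul, abs_neg, abs_of_pos (by positivity : 0 < 2 * α)]
  calc _ ≤ 2 * α * (K * (ε * M ^ (-(α + 1 / 2)))) := by gcongr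
    _ ≤ 2 * α * (K * (κ * (2 - α) ^ (-(α / 2)) / D * ((2 - α) ^ (-(1 / 4 : ℝ)) *
      (Real.log ℓ ^ 2 / ℓ ^ (min (1 / 4 : ℝ) α))))) := by gcongr
    _ = _ := by ring

end LevyLAN
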